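/- Let G be a (3k−2)-edge-connected bipartite graph with vertex classes A and B in which every vertex of A has even degree, and let p : B → Z/kZ satisfy Σ_{v∈B} p(v) ≡ e(G)/2 (mod k). Then G has a subgraph H with d(v,H) = d(v,G)/2 for every v ∈ A and d(v,H) ≡ p(v) (mod k) for every v ∈ B. -/

import Mathlib

/-- A loopless multigraph on vertex type `V` with edge type `E`. -/
structure Multigraph (V : Type) (E : Type) where
  ends : E → Sym2 V
  loopless : ∀ e, ¬ (ends e).IsDiag

namespace Multigraph

variable {V E : Type}

/-- Degree of a vertex. -/
noncomputable def deg (G : Multigraph V E) (v : V) : ℕ :=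
  Nat.card {e : E // v ∈ G.ends e}

/-- Degree of a vertex in the spanning subgraph with edge set `H`. -/
noncomputable def degOn (G : Multigraph V E) (H : Set E) (v : V) : ℕ :=
  Nat.card {e : E // e ∈ H ∧ v ∈ G.ends e}

/-- Degree of `v` in colour `j` under the edge-colouring `c`. -/
noncomputable def degCol {C : Type} (G : Multigraph V E) (c : E → C) (j : C) (v : V) : ℕ :=
  Nat.card {e : E // c e = j ∧ v ∈ G.ends e}

/-- Adjacency using only edges from `F`. -/
def Adj (G : Multigraph V E) (F : Set E) (v w : V) : Prop :=
  ∃ e ∈ F, G.ends e = s(v, w)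

/-- The spanning subgraph with edge set `F` is connected (on all of `V`). -/
def ConnectedOn (G : Multigraph V E) (F : Set E) : Prop :=
  ∀ v w : V, Relation.ReflTransGen (G.Adj F) v w

/-- `G` is connected. -/
def Connected (G : Multigraph V E) : Prop := G.ConnectedOn Set.univ

/-- `G` is `k`-edge-connected: removing fewer than `k` edges leaves it connected. -/
def EdgeConnected (G : Multigraph V E) (k : ℕ) : Prop :=
  ∀ F : Finset E, F.card < k → G.ConnectedOn {e | e ∉ F}

/-- The spanning subgraph with edge set `H` is `k`-edge-connected. -/
def EdgeConnectedOn (G : Multigraph V E) (H : Set E) (k : ℕ) : Prop :=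
  ∀ F : Finset E, ↑F ⊆ H → F.card < k → G.ConnectedOn (H \ ↑F)

/-- `S` is the edge set of a spanning tree of `G`. -/
def IsSpanningTree (G : Multigraph V E) (S : Set E) : Prop :=
  G.ConnectedOn S ∧ Nat.card S + 1 = Nat.card V

/-- `G` is a tree (connected with one fewer edge than vertices). -/
def IsTree (G : Multigraph V E) : Prop :=
  G.Connected ∧ Nat.card E + 1 = Nat.card V

/-- `H` is a homomorphic copy of `G`: it is obtained from `G` by identifying vertices,
keeping all edges (the vertex map is surjective and induces a bijection on edges). -/
def IsHomCopy {V' E' : Type} (G : Multigraph V E) (H : Multigraph V' E') : Prop :=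
  ∃ (f : V → V') (g : E ≃ E'), Function.Surjective f ∧
    ∀ e, H.ends (g e) = (G.ends e).map f

/-- `G` and `H` are isomorphic multigraphs. -/
def IsIsomorphic {V' E' : Type} (G : Multigraph V E) (H : Multigraph V' E') : Prop :=
  ∃ (f : V ≃ V') (g : E ≃ E'), ∀ e, H.ends (g e) = (G.ends e).map f

/-- The edge set `S` of `G` forms a subgraph which is a homomorphic copy of `T`. -/
def IsHomCopyOn {VT ET : Type} (T : Multigraph VT ET) (G : Multigraph V E) (S : Set E) : Prop :=
  ∃ (f : VT → V) (g : ET ≃ S), ∀ e, G.ends (g e) = (T.ends e).map f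

/-- The edge set `S` of `G` forms a subgraph isomorphic to `T`. -/
def IsIsoCopyOn {VT ET : Type} (T : Multigraph VT ET) (G : Multigraph V E) (S : Set E) : Prop :=
  ∃ (f : VT → V) (g : ET ≃ S), Function.Injective f ∧
    ∀ e, G.ends (g e) = (T.ends e).map f

/-- `A`, `B` form a bipartition of `G`. -/
def IsBipartition (G : Multigraph V E) (A B : Set V) : Prop :=
  Disjoint A B ∧ A ∪ B = Set.univ ∧ ∀ e : E, ∃ a ∈ A, ∃ b ∈ B, G.ends e = s(a, b)

/-- A `T*`-decomposition: a partition of the edge set of `G` into homomorphic copies of `T`. -/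
def HomCopyDecomposition {VT ET : Type} (T : Multigraph VT ET) (G : Multigraph V E) : Prop :=
  ∃ P : Set (Set E), Setoid.IsPartition P ∧ ∀ S ∈ P, T.IsHomCopyOn G S

/-- A `T`-decomposition: a partition of the edge set of `G` into copies isomorphic to `T`. -/
def IsoCopyDecomposition {VT ET : Type} (T : Multigraph VT ET) (G : Multigraph V E) : Prop :=
  ∃ P : Set (Set E), Setoid.IsPartition P ∧ ∀ S ∈ P, T.IsIsoCopyOn G S

/-- There is a walk of length `n` from `v` to `w` in `G`. -/
def WalkLen (G : Multigraph V E) (n : ℕ) (v w : V) : Prop :=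
  ∃ (p : Fin (n + 1) → V) (e : Fin n → E), p 0 = v ∧ p (Fin.last n) = w ∧
    ∀ i : Fin n, G.ends (e i) = s(p i.castSucc, p i.succ)

/-- Graph distance. -/
noncomputable def dist (G : Multigraph V E) (v w : V) : ℕ :=
  sInf {n | G.WalkLen n v w}

/-- Diameter of a finite graph. -/
noncomputable def diam (G : Multigraph V E) [Fintype V] : ℕ :=
  Finset.univ.sup fun p : V × V => G.dist p.1 p.2

/-- `G` contains a cycle of length `n`. -/
def HasCycleOfLength (G : Multigraph V E) (n : ℕ) : Prop :=
  2 ≤ n ∧ ∃ (v : ZMod n → V) (e : ZMod n → E), Function.Injective v ∧ Function.Injective e ∧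
    ∀ i, G.ends (e i) = s(v i, v (i + 1))

end Multigraph

/-- The distance from `n` to the nearest multiple of `2 * k`. -/
def circNorm (k : ℕ) (n : ℤ) : ℤ := |Int.bmod n (2 * k)|

section circNorm

variable {k : ℕ}

theorem circNorm_exists (hk : 0 < k) (n : ℤ) :
    ∃ q r : ℤ, n = (2 * k : ℤ) * q + r ∧ -k ≤ r ∧ r < k ∧ circNorm k n = |r| := by
  refine ⟨n.bdiv (2 * k), n.bmod (2 * k), ?_, ?_, ?_, rfl⟩
  · have := Int.bdiv_add_bmod n (2 * k)
    push_cast at this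
    exact this.symm
  · have := Int.le_bmod (x := n) (m := 2 * k) (by omega)
    push_cast at this
    omega
  · have := Int.bmod_lt (x := n) (m := 2 * k) (by omega)
    push_cast at this
    omega

theorem circNorm_nonneg (n : ℤ) : 0 ≤ circNorm k n := abs_nonneg _

theorem circNorm_congr {a b : ℤ} (h : (2 * k : ℤ) ∣ a - b) : circNorm k a = circNorm k b := by
  obtain ⟨c, hc⟩ := h
  obtain rfl : a = b + ((2 * k : ℕ) : ℤ) * c := by push_cast; linarith
  rw [circNorm, circNorm, Int.add_mul_bmod_self_left]

theorem circNorm_eq (hk : 0 < k) {n r : ℤ} (h : (2 * k : ℤ) ∣ n - r) (hr : |r| ≤ k) :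
    circNorm k n = |r| := by
  rw [circNorm_congr h]
  obtain ⟨q, s, h1, h2, h3, h4⟩ := circNorm_exists hk r
  rw [h4]
  rw [abs_le] at hr
  have hk' : (0 : ℤ) < k := by exact_mod_cast hk
  have hq1 : q < 2 := by
    by_contra hc
    nlinarith
  have hq2 : -1 < q := by
    by_contra hc
    nlinarith
  obtain rfl | rfl : q = 0 ∨ q = 1 := by omega
  · rw [show s = r by linarith]
  · rw [show s = -k by linarith, show r = k by linarith, abs_neg]

theorem circNorm_le (hk : 0 < k) (n : ℤ) : circNorm k n ≤ k := by
  obtain ⟨q, s, h1, h2, h3, h4⟩ := circNorm_exists hk n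
  rw [h4, abs_le]
  omega

theorem circNorm_neg (hk : 0 < k) (n : ℤ) : circNorm k (-n) = circNorm k n := by
  obtain ⟨q, s, h1, h2, h3, h4⟩ := circNorm_exists hk n
  rw [h4, circNorm_eq hk (r := -s), abs_neg]
  · exact ⟨-q, by rw [h1]; ring⟩
  · rw [abs_neg, abs_le]; omega

theorem two_dvd_circNorm_sub (hk : 0 < k) (n : ℤ) : 2 ∣ circNorm k n - n := by
  obtain ⟨q, s, h1, h2, h3, h4⟩ := circNorm_exists hk n
  rw [h4, h1, mul_assoc]
  generalize (k : ℤ) * q = z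
  rcases abs_cases s with h | h <;> omega

theorem circNorm_succ (hk : 0 < k) (n : ℤ) :
    circNorm k (n + 1) = circNorm k n + 1 ∨ circNorm k (n + 1) = circNorm k n - 1 := by
  obtain ⟨q, s, h1, h2, h3, h4⟩ := circNorm_exists hk n
  rw [circNorm_eq hk (n := n + 1) (r := s + 1) ⟨q, by rw [h1]; ring⟩ (by rw [abs_le]; omega), h4]
  rcases abs_cases s with h | h <;> rcases abs_cases (s + 1) with h' | h' <;> omega

theorem circNorm_pred (hk : 0 < k) (n : ℤ) :
    circNorm k (n - 1) = circNorm k n + 1 ∨ circNorm k (n - 1) = circNorm k n - 1 := by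
  have := circNorm_succ hk (n - 1)
  rw [sub_add_cancel] at this
  omega

theorem circNorm_add_le (hk : 0 < k) (a b : ℤ) :
    circNorm k (a + b) ≤ circNorm k a + circNorm k b := by
  obtain ⟨q, s, h1, h2, h3, h4⟩ := circNorm_exists hk a
  obtain ⟨q', s', h1', h2', h3', h4'⟩ := circNorm_exists hk b
  have hle := abs_add_le s s'
  have hcong : circNorm k (a + b) = circNorm k (s + s') :=
    circNorm_congr ⟨q + q', by rw [h1, h1']; ring⟩
  rw [hcong, h4, h4']
  by_cases h : |s + s'| ≤ k
  · rw [circNorm_eq hk (r := s + s') (by simp) h]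
    exact hle
  · have := circNorm_le hk (s + s')
    omega

theorem circNorm_add_le_abs (hk : 0 < k) (a b : ℤ) : circNorm k (a + b) ≤ circNorm k a + |b| := by
  refine (circNorm_add_le hk a b).trans (add_le_add le_rfl ?_)
  by_cases h : |b| ≤ k
  · rw [circNorm_eq hk (r := b) (by simp) h]
  · have := circNorm_le hk b
    omega

/-- If subtracting `1` does not decrease the norm, then `n` is represented by a nonpositive
residue. -/
theorem dvd_add_circNorm (hk : 0 < k) {n : ℤ} (h : circNorm k (n - 1) = circNorm k n + 1) :
    (2 * k : ℤ) ∣ n + circNorm k n := by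
  obtain ⟨q, s, h1, h2, h3, h4⟩ := circNorm_exists hk n
  rcases le_or_gt s 0 with hs | hs
  · rw [h4, abs_of_nonpos hs, h1]
    exact ⟨q, by ring⟩
  · exfalso
    rw [circNorm_eq hk (n := n - 1) (r := s - 1) ⟨q, by rw [h1]; ring⟩ (by rw [abs_le]; omega), h4]
      at h
    rcases abs_cases s with h | h <;> rcases abs_cases (s - 1) with h' | h' <;> omega

theorem circNorm_eq_of_pred_of_succ (hk : 0 < k) {n : ℤ}
    (h : circNorm k (n - 1) = circNorm k n - 1) (h' : circNorm k (n + 1) = circNorm k n - 1) :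
    circNorm k n = k := by
  obtain ⟨q, s, h1, h2, h3, h4⟩ := circNorm_exists hk n
  rw [circNorm_eq hk (n := n + 1) (r := s + 1) ⟨q, by rw [h1]; ring⟩ (by rw [abs_le]; omega), h4]
    at h'
  rcases eq_or_lt_of_le h2 with h2 | h2
  · rw [h4, ← h2]; simp
  rw [circNorm_eq hk (n := n - 1) (r := s - 1) ⟨q, by rw [h1]; ring⟩ (by rw [abs_le]; omega), h4]
    at h
  rcases abs_cases s with h | h <;> rcases abs_cases (s - 1) with h' | h' <;>
    rcases abs_cases (s + 1) with h'' | h'' <;> omega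

theorem circNorm_pred_or_succ (hk : 0 < k) {n : ℤ} (h : circNorm k n ≠ 0) :
    circNorm k (n - 1) = circNorm k n - 1 ∨ circNorm k (n + 1) = circNorm k n - 1 := by
  obtain ⟨q, s, h1, h2, h3, h4⟩ := circNorm_exists hk n
  rw [h4] at h ⊢
  rcases le_or_gt s 0 with hs | hs
  · right
    rw [circNorm_eq hk (n := n + 1) (r := s + 1) ⟨q, by rw [h1]; ring⟩ (by rw [abs_le]; omega)]
    have : s ≠ 0 := by simpa using h
    rw [abs_of_nonpos hs, abs_of_nonpos (by omega)]
    ring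
  · left
    rw [circNorm_eq hk (n := n - 1) (r := s - 1) ⟨q, by rw [h1]; ring⟩ (by rw [abs_le]; omega)]
    rw [abs_of_pos hs, abs_of_nonneg (by omega)]

theorem dvd_of_circNorm_eq_zero (hk : 0 < k) {n : ℤ} (h : circNorm k n = 0) :
    (2 * k : ℤ) ∣ n := by
  obtain ⟨q, s, h1, h2, h3, h4⟩ := circNorm_exists hk n
  have : s = 0 := by simpa [h4] using h
  exact ⟨q, by rw [h1, this, add_zero]⟩

end circNorm

/-- A finite multigraph with vertex set `verts` and edge multiplicities `mult`, together with
a root outside of `verts` all of whose edges are already oriented: `inn v` of them point from the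
root to `v` and `out v` of them point from `v` to the root. The integer `bal v` prescribes the
out-degree minus the in-degree at `v`, modulo some even number at the vertices of `terms`. -/
structure RootedNetwork (V : Type) where
  verts : Finset V
  terms : Finset V
  mult : V → V → ℤ
  inn : V → ℤ
  out : V → ℤ
  bal : V → ℤ

namespace RootedNetwork

variable {V : Type} [DecidableEq V] {k : ℕ}

/-- The number of edges leaving `A`, including those going to the root. -/
def cut (S : RootedNetwork V) (A : Finset V) : ℤ :=
  ∑ u ∈ A, ∑ v ∈ S.verts \ A, S.mult u v + ∑ u ∈ A, (S.inn u + S.out u)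

/-- Out-degree minus in-degree of `v` when `f u w` edges are directed from `u` to `w`. -/
def net (S : RootedNetwork V) (f : V → V → ℤ) (v : V) : ℤ :=
  ∑ u ∈ S.verts, (f v u - f u v) + S.out v - S.inn v

/-- There is an orientation which is balanced outside of the terminals and which has the prescribed
balance modulo `2 * k` at the terminals. -/
def Solvable (S : RootedNetwork V) (k : ℕ) : Prop :=
  ∃ f : V → V → ℤ, (∀ u v, 0 ≤ f u v) ∧
    (∀ u ∈ S.verts, ∀ v ∈ S.verts, u ≠ v → f u v + f v u = S.mult u v) ∧
    (∀ v ∈ S.terms, (2 * k : ℤ) ∣ S.net f v - S.bal v) ∧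
    ∀ v ∈ S.verts, v ∉ S.terms → S.net f v = 0

/-- The hypotheses on the cuts under which a rooted network is solvable. -/
structure Good (S : RootedNetwork V) (k : ℕ) : Prop where
  terms_subset : S.terms ⊆ S.verts
  terms_nonempty : S.terms.Nonempty
  symm : ∀ u v, S.mult u v = S.mult v u
  mult_nonneg : ∀ u v, 0 ≤ S.mult u v
  inn_nonneg : ∀ v, 0 ≤ S.inn v
  out_nonneg : ∀ v, 0 ≤ S.out v
  parity : ∀ v ∈ S.verts, 2 ∣ S.cut {v} - S.bal v
  bal_sum : (2 * k : ℤ) ∣ ∑ v ∈ S.verts, S.bal v - ∑ v ∈ S.verts, (S.out v - S.inn v)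
  bal_off : ∀ v ∈ S.verts, v ∉ S.terms → (2 * k : ℤ) ∣ S.bal v
  root : S.cut S.verts ≤ 2 * k - 2 + circNorm k (∑ v ∈ S.verts, S.bal v)
  le_cut : ∀ A, A ⊂ S.verts → (A ∩ S.terms).Nonempty →
    2 * k - 2 + circNorm k (∑ v ∈ A, S.bal v) ≤ S.cut A

/-- The well-founded order along which solvability is proved. -/
def Smaller (S' S : RootedNetwork V) : Prop :=
  S'.verts.card < S.verts.card ∨ S'.verts = S.verts ∧
    (∑ u ∈ S'.verts, ∑ v ∈ S'.verts, S'.mult u v < ∑ u ∈ S.verts, ∑ v ∈ S.verts, S.mult u v ∨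
      ∑ u ∈ S'.verts, ∑ v ∈ S'.verts, S'.mult u v = ∑ u ∈ S.verts, ∑ v ∈ S.verts, S.mult u v ∧
        S'.cut S'.verts + S'.terms.card < S.cut S.verts + S.terms.card)

/-- The indicator of the pair `(x, y)`. -/
def arc (x y u v : V) : ℤ := if u = x then if v = y then 1 else 0 else 0

theorem arc_nonneg (x y u v : V) : 0 ≤ arc x y u v := by
  unfold arc; split_ifs <;> simp

theorem sum_arc (x y : V) (A B : Finset V) :
    ∑ u ∈ A, ∑ v ∈ B, arc x y u v = if x ∈ A then if y ∈ B then 1 else 0 else 0 := by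
  simp only [arc]
  rw [Finset.sum_congr rfl (g := fun u => if u = x then if y ∈ B then (1 : ℤ) else 0 else 0)]
  · simp
  · intro u _
    split_ifs <;> simp_all

theorem sum_arc_left (x y v : V) (B : Finset V) :
    ∑ u ∈ B, arc x y v u = if v = x then if y ∈ B then 1 else 0 else 0 := by
  have := sum_arc x y {v} B
  rwa [Finset.sum_singleton, if_congr (Finset.mem_singleton.trans eq_comm) rfl rfl] at this

theorem sum_arc_right (x y v : V) (B : Finset V) :
    ∑ u ∈ B, arc x y u v = if x ∈ B then if v = y then 1 else 0 else 0 := by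
  have := sum_arc x y B {v}
  simpa only [Finset.sum_singleton, Finset.mem_singleton, @eq_comm _ v] using this

theorem sum_arc_cut {x y : V} {A W : Finset V} (hx : x ∈ W) (hy : y ∈ W) :
    ∑ u ∈ A, ∑ v ∈ W \ A, (arc x y u v + arc y x u v) = if (x ∈ A ↔ y ∈ A) then 0 else 1 := by
  simp only [Finset.sum_add_distrib, sum_arc, Finset.mem_sdiff, hx, hy, true_and]
  by_cases h1 : x ∈ A <;> by_cases h2 : y ∈ A <;> simp [h1, h2]

theorem cut_verts (S : RootedNetwork V) : S.cut S.verts = ∑ u ∈ S.verts, (S.inn u + S.out u) := by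
  simp [cut]

theorem cut_singleton (S : RootedNetwork V) (v : V) :
    S.cut {v} = ∑ u ∈ S.verts \ {v}, S.mult v u + (S.inn v + S.out v) := by
  simp [cut]

theorem cut_union {S : RootedNetwork V} (hs : ∀ u v, S.mult u v = S.mult v u) {A B : Finset V}
    (hAB : Disjoint A B) (hA : A ⊆ S.verts) (hB : B ⊆ S.verts) :
    S.cut (A ∪ B) = S.cut A + S.cut B - 2 * ∑ u ∈ A, ∑ v ∈ B, S.mult u v := by
  have h1 : S.verts \ A = S.verts \ (A ∪ B) ∪ B := by
    ext x
    have : x ∈ B → x ∈ S.verts := fun h => hB h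
    have : x ∈ B → x ∉ A := fun h => Finset.disjoint_right.1 hAB h
    simp only [Finset.mem_sdiff, Finset.mem_union]
    tauto
  have h2 : S.verts \ B = S.verts \ (A ∪ B) ∪ A := by
    ext x
    have : x ∈ A → x ∈ S.verts := fun h => hA h
    have : x ∈ B → x ∉ A := fun h => Finset.disjoint_right.1 hAB h
    simp only [Finset.mem_sdiff, Finset.mem_union]
    tauto
  have h3 : Disjoint (S.verts \ (A ∪ B)) A :=
    Finset.disjoint_of_subset_right Finset.subset_union_left Finset.sdiff_disjoint
  have h4 : Disjoint (S.verts \ (A ∪ B)) B :=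
    Finset.disjoint_of_subset_right Finset.subset_union_right Finset.sdiff_disjoint
  have h5 : ∑ u ∈ B, ∑ v ∈ A, S.mult u v = ∑ u ∈ A, ∑ v ∈ B, S.mult u v := by
    rw [Finset.sum_comm]
    simp only [hs]
  simp only [cut, h1, h2]
  simp only [Finset.sum_union hAB, Finset.sum_union h3, Finset.sum_union h4,
    Finset.sum_add_distrib, h5]
  ring

theorem two_dvd_cut_sub {S : RootedNetwork V} (hs : ∀ u v, S.mult u v = S.mult v u)
    (hp : ∀ v ∈ S.verts, 2 ∣ S.cut {v} - S.bal v) {A : Finset V} (hA : A ⊆ S.verts) :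
    2 ∣ S.cut A - ∑ v ∈ A, S.bal v := by
  induction A using Finset.induction_on with
  | empty => simp [cut]
  | insert a A ha ih =>
    rw [Finset.insert_subset_iff] at hA
    rw [Finset.sum_insert ha, Finset.insert_eq, cut_union hs (by simpa using ha) (by simpa using hA.1)
      hA.2]
    have := ih hA.2
    have := hp a hA.1
    omega

theorem Good.le_cut_add_two {S : RootedNetwork V} (hk : 0 < k) (hS : S.Good k) {A : Finset V}
    (hA : A ⊆ S.verts) (h : 2 * k - 2 + circNorm k (∑ v ∈ A, S.bal v) < S.cut A) :
    2 * k + circNorm k (∑ v ∈ A, S.bal v) ≤ S.cut A := by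
  have := two_dvd_cut_sub hS.symm hS.parity hA
  have := two_dvd_circNorm_sub hk (∑ v ∈ A, S.bal v)
  omega

/-- All prescribed orientations reversed. -/
def rev (S : RootedNetwork V) : RootedNetwork V where
  verts := S.verts
  terms := S.terms
  mult := S.mult
  inn := S.out
  out := S.inn
  bal v := -S.bal v

theorem cut_rev (S : RootedNetwork V) (A : Finset V) : S.rev.cut A = S.cut A := by
  simp [cut, rev, add_comm]

theorem Good.rev {S : RootedNetwork V} (hk : 0 < k) (hS : S.Good k) : S.rev.Good k where
  terms_subset := hS.terms_subset
  terms_nonempty := hS.terms_nonempty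
  symm := hS.symm
  mult_nonneg := hS.mult_nonneg
  inn_nonneg := hS.out_nonneg
  out_nonneg := hS.inn_nonneg
  parity v hv := by
    rw [cut_rev]
    have := hS.parity v hv
    rw [show S.rev.bal v = -S.bal v from rfl]
    omega
  bal_sum := by
    have := Int.dvd_neg.2 hS.bal_sum
    change (2 * k : ℤ) ∣ ∑ v ∈ S.verts, -S.bal v - ∑ v ∈ S.verts, (S.inn v - S.out v)
    have e : ∑ v ∈ S.verts, -S.bal v - ∑ v ∈ S.verts, (S.inn v - S.out v)
        = -(∑ v ∈ S.verts, S.bal v - ∑ v ∈ S.verts, (S.out v - S.inn v)) := by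
      simp only [Finset.sum_sub_distrib, Finset.sum_neg_distrib]
      ring
    rwa [e]
  bal_off v hv hv' := Int.dvd_neg.2 (hS.bal_off v hv hv')
  root := by
    rw [cut_rev]
    simpa [RootedNetwork.rev, circNorm_neg hk] using hS.root
  le_cut A h1 h2 := by
    rw [cut_rev]
    simpa [RootedNetwork.rev, circNorm_neg hk] using hS.le_cut A h1 h2

omit [DecidableEq V] in
theorem Solvable.of_rev {S : RootedNetwork V} (h : S.rev.Solvable k) : S.Solvable k := by
  obtain ⟨f, h1, h2, h3, h4⟩ := h
  have hnet : ∀ v, S.net (fun u v => f v u) v = -S.rev.net f v := by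
    intro v
    simp only [net, RootedNetwork.rev, Finset.sum_sub_distrib]
    ring
  refine ⟨fun u v => f v u, fun u v => h1 v u, fun u hu v hv huv => ?_, fun v hv => ?_,
    fun v hv hv' => ?_⟩
  · rw [add_comm]
    exact h2 u hu v hv huv
  · rw [hnet]
    have := h3 v hv
    rwa [show S.rev.net f v - S.rev.bal v = -(-S.rev.net f v - S.bal v) by
      rw [show S.rev.bal v = -S.bal v from rfl]; ring, dvd_neg] at this
  · rw [hnet, h4 v hv hv', neg_zero]

theorem Smaller.of_rev {S S' : RootedNetwork V} (h : S'.Smaller S.rev) : S'.Smaller S := by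
  unfold Smaller at *
  rwa [cut_rev] at h

/-- Orientations can be transferred along a local modification of the network. -/
theorem Solvable.of_modification {S S' : RootedNetwork V} (h : S'.Solvable k)
    (hv : S'.verts = S.verts) (ht : S'.terms = S.terms)
    (hf : ∀ f : V → V → ℤ, (∀ u v, 0 ≤ f u v) →
      (∀ u ∈ S.verts, ∀ v ∈ S.verts, u ≠ v → f u v + f v u = S'.mult u v) →
      ∃ g : V → V → ℤ, (∀ u v, 0 ≤ f u v + g u v) ∧
        (∀ u ∈ S.verts, ∀ v ∈ S.verts, u ≠ v → g u v + g v u = S.mult u v - S'.mult u v) ∧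
        ∀ v ∈ S.verts, ∑ u ∈ S.verts, (g v u - g u v) + (S.out v - S'.out v)
          - (S.inn v - S'.inn v) = if v ∈ S.terms then S.bal v - S'.bal v else 0)
    (hsub : S.terms ⊆ S.verts) : S.Solvable k := by
  obtain ⟨f, h1, h2, h3, h4⟩ := h
  rw [hv] at h2 h4
  rw [ht] at h3 h4
  obtain ⟨g, g1, g2, g3⟩ := hf f h1 h2
  have hnet : ∀ v ∈ S.verts, S.net (fun u v => f u v + g u v) v
      = S'.net f v + if v ∈ S.terms then S.bal v - S'.bal v else 0 := by
    intro v hv'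
    rw [← g3 v hv']
    simp only [net, hv, Finset.sum_sub_distrib, Finset.sum_add_distrib]
    ring
  refine ⟨fun u v => f u v + g u v, g1, fun u hu v hv huv => ?_, fun v hv => ?_,
    fun v hv hv' => ?_⟩
  · have := h2 u hu v hv huv
    have := g2 u hu v hv huv
    linarith
  · rw [hnet v (hsub hv), if_pos hv]
    convert h3 v hv using 1
    ring
  · rw [hnet v hv, h4 v hv hv', if_neg hv', add_zero]

/-- Delete an edge `xy` after orienting it from `x` to `y`, and add `α v` edges from the root to `v`
and `β v` edges from `v` to the root. -/
def removeEdge (S : RootedNetwork V) (x y : V) (α β : V → ℤ) : RootedNetwork V where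
  verts := S.verts
  terms := S.terms
  mult u v := S.mult u v - (arc x y u v + arc y x u v)
  inn v := S.inn v + α v
  out v := S.out v + β v
  bal v := S.bal v - (if v = x then 1 else 0) + (if v = y then 1 else 0) + (β v - α v)

theorem cut_removeEdge {S : RootedNetwork V} {x y : V} (hx : x ∈ S.verts) (hy : y ∈ S.verts)
    (α β : V → ℤ) (A : Finset V) :
    (S.removeEdge x y α β).cut A
      = S.cut A - (if (x ∈ A ↔ y ∈ A) then 0 else 1) + ∑ v ∈ A, (α v + β v) := by
  rw [← sum_arc_cut hx hy]
  simp only [cut, removeEdge, Finset.sum_sub_distrib, Finset.sum_add_distrib]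
  ring

theorem sum_bal_removeEdge (S : RootedNetwork V) (x y : V) (α β : V → ℤ) (A : Finset V) :
    ∑ v ∈ A, (S.removeEdge x y α β).bal v
      = ∑ v ∈ A, S.bal v - (if x ∈ A then 1 else 0) + (if y ∈ A then 1 else 0)
        + ∑ v ∈ A, (β v - α v) := by
  simp [removeEdge, Finset.sum_sub_distrib, Finset.sum_add_distrib]

theorem solvable_of_removeEdge {S : RootedNetwork V} (hS : S.Good k)
    (ih : ∀ S' : RootedNetwork V, S'.Good k → S'.Smaller S → S'.Solvable k) {x y : V}
    (hx : x ∈ S.verts) (hy : y ∈ S.verts) (hxy : x ≠ y) (hm : 0 < S.mult x y) (α β : V → ℤ)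
    (hα : ∀ v, 0 ≤ S.inn v + α v) (hβ : ∀ v, 0 ≤ S.out v + β v)
    (hoff : ∀ v ∈ S.verts, v ∉ S.terms → (S.removeEdge x y α β).bal v = S.bal v)
    (hroot : S.cut S.verts + ∑ v ∈ S.verts, (α v + β v)
      ≤ 2 * k - 2 + circNorm k (∑ v ∈ S.verts, S.bal v + ∑ v ∈ S.verts, (β v - α v)))
    (hcut : ∀ A, A ⊂ S.verts → (A ∩ S.terms).Nonempty →
      2 * k - 2 + circNorm k (∑ v ∈ A, S.bal v - (if x ∈ A then 1 else 0)
        + (if y ∈ A then 1 else 0) + ∑ v ∈ A, (β v - α v))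
      ≤ S.cut A - (if (x ∈ A ↔ y ∈ A) then 0 else 1) + ∑ v ∈ A, (α v + β v)) :
    S.Solvable k := by
  have hgood : (S.removeEdge x y α β).Good k :=
    { terms_subset := hS.terms_subset
      terms_nonempty := hS.terms_nonempty
      symm := fun u v => by
        have := hS.symm u v
        simp only [removeEdge, arc]
        split_ifs <;> simp_all
      mult_nonneg := fun u v => by
        have := hS.mult_nonneg u v
        have := hS.symm x y
        simp only [removeEdge, arc]
        split_ifs <;> simp_all <;> omega
      inn_nonneg := hα
      out_nonneg := hβ
      parity := fun v hv => by
        rw [cut_removeEdge hx hy]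
        have := hS.parity v hv
        simp only [removeEdge, Finset.mem_singleton, Finset.sum_singleton, @eq_comm _ v]
        split_ifs <;> simp_all <;> omega
      bal_sum := by
        convert hS.bal_sum using 1
        rw [show (S.removeEdge x y α β).verts = S.verts from rfl, sum_bal_removeEdge]
        simp only [removeEdge, hx, hy, if_true, Finset.sum_sub_distrib, Finset.sum_add_distrib]
        ring
      bal_off := fun v hv hv' => by
        rw [hoff v hv hv']
        exact hS.bal_off v hv hv'
      root := by
        rw [show (S.removeEdge x y α β).verts = S.verts from rfl, sum_bal_removeEdge,
          cut_removeEdge hx hy]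
        simpa [hx, hy] using hroot
      le_cut := fun A hA hA' => by
        rw [sum_bal_removeEdge, cut_removeEdge hx hy]
        exact hcut A hA hA' }
  refine Solvable.of_modification (ih _ hgood ?_) rfl rfl ?_ hS.terms_subset
  · refine Or.inr ⟨rfl, Or.inl ?_⟩
    simp only [removeEdge, Finset.sum_sub_distrib, Finset.sum_add_distrib, sum_arc, hx, hy, if_true]
    omega
  · intro f hf _
    refine ⟨arc x y, fun u v => add_nonneg (hf u v) (arc_nonneg x y u v), fun u _ v _ huv => ?_,
      fun v hv => ?_⟩
    · simp only [removeEdge, arc]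
      split_ifs <;> simp_all
    · have h : S.bal v - (S.removeEdge x y α β).bal v
          = if v ∈ S.terms then S.bal v - (S.removeEdge x y α β).bal v else 0 := by
        by_cases hv' : v ∈ S.terms
        · rw [if_pos hv']
        · rw [if_neg hv', hoff v hv hv', sub_self]
      rw [← h]
      simp only [removeEdge, Finset.sum_sub_distrib, sum_arc_left, sum_arc_right, hx, hy, if_true]
      ring

theorem arc_comm (x y u v : V) : arc x y u v = arc y x v u := by
  unfold arc; split_ifs <;> rfl

/-- Every cut which contains a terminal and at least two vertices can be lowered. -/
def Slack (S : RootedNetwork V) (k : ℕ) : Prop :=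
  ∀ A, A ⊂ S.verts → 1 < A.card → (A ∩ S.terms).Nonempty →
    2 * k + circNorm k (∑ v ∈ A, S.bal v) ≤ S.cut A

theorem Slack.forall {S : RootedNetwork V} {P : Finset V → Prop} (hslack : S.Slack k)
    (h1 : ∀ z ∈ S.terms, z ∈ S.verts → P {z})
    (h2 : ∀ A, A ⊂ S.verts → 2 * k + circNorm k (∑ v ∈ A, S.bal v) ≤ S.cut A → P A)
    (A : Finset V) (hA : A ⊂ S.verts) (hA' : (A ∩ S.terms).Nonempty) : P A := by
  by_cases hc : 1 < A.card
  · exact h2 A hA (hslack A hA hc hA')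
  · obtain ⟨z, hz⟩ := hA'
    rw [Finset.mem_inter] at hz
    obtain rfl : A = {z} := by
      ext y
      rw [Finset.mem_singleton]
      exact ⟨fun hy => Finset.card_le_one.1 (not_lt.1 hc) y hy z hz.1, fun hy => hy ▸ hz.1⟩
    exact h1 z hz.2 (hA.1 hz.1)

theorem Good.le_cut_singleton {S : RootedNetwork V} (hS : S.Good k) {z w : V} (hz : z ∈ S.terms)
    (hw : w ∈ S.verts) (hwz : w ≠ z) : 2 * k - 2 + circNorm k (S.bal z) ≤ S.cut {z} := by
  have h1 : ({z} : Finset V) ⊂ S.verts :=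
    (Finset.ssubset_iff_of_subset (Finset.singleton_subset_iff.2 (hS.terms_subset hz))).2
      ⟨w, hw, by simpa using hwz⟩
  have h2 := hS.le_cut {z} h1
    (by rw [Finset.singleton_inter_of_mem hz]; exact Finset.singleton_nonempty z)
  rwa [Finset.sum_singleton] at h2

theorem Slack.rev {S : RootedNetwork V} (hk : 0 < k) (hslack : S.Slack k) :
    S.rev.Slack k := by
  intro A h1 h2 h3
  rw [cut_rev]
  simpa [RootedNetwork.rev, circNorm_neg hk] using hslack A h1 h2 h3

theorem Good.exists_mult_pos {S : RootedNetwork V} (hS : S.Good k) {v : V} (hv : v ∈ S.verts)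
    (hvT : v ∉ S.terms) (h : 0 < S.inn v + S.out v) : ∃ u ∈ S.verts, u ≠ v ∧ 0 < S.mult v u := by
  by_contra! hcon
  have hsub : S.terms ⊆ S.verts.erase v := fun t ht =>
    Finset.mem_erase.2 ⟨fun e => hvT (e ▸ ht), hS.terms_subset ht⟩
  have h1 := hS.le_cut _ (Finset.erase_ssubset hv)
    (by rw [Finset.inter_eq_right.2 hsub]; exact hS.terms_nonempty)
  have h2 := hS.root
  have h3 := cut_union hS.symm (Finset.disjoint_singleton_right.2 (Finset.notMem_erase v S.verts))
    (Finset.erase_subset v S.verts) (Finset.singleton_subset_iff.2 hv)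
  have h4 : ∀ u ∈ S.verts.erase v, ∑ w ∈ {v}, S.mult u w = 0 := by
    intro u hu
    rw [Finset.mem_erase] at hu
    rw [Finset.sum_singleton, hS.symm]
    exact le_antisymm (hcon u hu.2 hu.1) (hS.mult_nonneg v u)
  have h5 : ∑ u ∈ S.verts \ {v}, S.mult v u = 0 := by
    refine Finset.sum_eq_zero fun u hu => ?_
    rw [Finset.mem_sdiff, Finset.mem_singleton] at hu
    exact le_antisymm (hcon u hu.1 hu.2) (hS.mult_nonneg v u)
  rw [Finset.sum_eq_zero h4, cut_singleton, h5, Finset.erase_eq,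
    Finset.sdiff_union_of_subset (Finset.singleton_subset_iff.2 hv), ← Finset.erase_eq] at h3
  have h6 : circNorm k (∑ u ∈ S.verts.erase v, S.bal u) = circNorm k (∑ u ∈ S.verts, S.bal u) := by
    apply circNorm_congr
    rw [← Finset.add_sum_erase _ _ hv, sub_add_cancel_right, dvd_neg]
    exact hS.bal_off v hv hvT
  omega

theorem solvable_of_inn_pos {S : RootedNetwork V} (hS : S.Good k)
    (ih : ∀ S' : RootedNetwork V, S'.Good k → S'.Smaller S → S'.Solvable k)
    (hslack : S.Slack k) {v : V} (hv : v ∈ S.verts) (hvT : v ∉ S.terms) (h : 0 < S.inn v) :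
    S.Solvable k := by
  obtain ⟨u, hu, huv, hm⟩ := hS.exists_mult_pos hv hvT
    (add_pos_of_pos_of_nonneg h (hS.out_nonneg v))
  have hsum : ∀ A : Finset V,
      ∑ w ∈ A, ((if w = u then 1 else 0) - (if w = v then 1 else 0) : ℤ)
        = (if u ∈ A then 1 else 0) - (if v ∈ A then 1 else 0) := by
    intro A
    simp [Finset.sum_sub_distrib]
  refine solvable_of_removeEdge hS ih hv hu huv.symm hm
    (fun w => (if w = u then 1 else 0) - (if w = v then 1 else 0)) (fun _ => 0) (fun w => ?_)
    (fun w => by simpa using hS.out_nonneg w) (fun w _ _ => ?_) ?_ ?_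
  · have := hS.inn_nonneg w
    split_ifs with h1 h2 h2
    · omega
    · omega
    · subst h2
      omega
    · omega
  · simp only [removeEdge]
    ring
  · simp only [add_zero, zero_sub, Finset.sum_neg_distrib, hsum, hu, hv, if_true, sub_self,
      neg_zero]
    exact hS.root
  · intro A hA hA'
    have := hslack.forall (P := fun A => 2 * k - 2 + circNorm k (∑ w ∈ A, S.bal w)
      + (if v ∈ A then if u ∈ A then 0 else 2 else 0) ≤ S.cut A) ?_ ?_ A hA hA'
    · simp only [add_zero, zero_sub, Finset.sum_neg_distrib, hsum]
      rw [show ∀ a b c : ℤ, a - b + c + -(c - b) = a by intros; ring]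
      by_cases h1 : v ∈ A <;> by_cases h2 : u ∈ A <;> simp [h1, h2] at this ⊢ <;> omega
    · intro z hz hz'
      have := hS.le_cut_singleton hz hv (ne_of_mem_of_not_mem hz hvT).symm
      have h3 : v ∉ ({z} : Finset V) := by
        rw [Finset.mem_singleton]
        rintro rfl
        exact hvT hz
      simpa [h3] using this
    · intro A _ h
      split_ifs <;> omega

theorem solvable_of_out_pos {S : RootedNetwork V} (hk : 0 < k) (hS : S.Good k)
    (ih : ∀ S' : RootedNetwork V, S'.Good k → S'.Smaller S → S'.Solvable k)
    (hslack : S.Slack k) {v : V} (hv : v ∈ S.verts) (hvT : v ∉ S.terms) (h : 0 < S.out v) :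
    S.Solvable k :=
  Solvable.of_rev (solvable_of_inn_pos (hS.rev hk) (fun _ h1 h2 => ih _ h1 h2.of_rev)
    (Slack.rev hk hslack) hv hvT h)
/-- Replace a path `uvw` by an edge `uw`. -/
def lift (S : RootedNetwork V) (u v w : V) : RootedNetwork V where
  verts := S.verts
  terms := S.terms
  mult a b := S.mult a b - (arc u v a b + arc v u a b) - (arc v w a b + arc w v a b)
    + (arc u w a b + arc w u a b)
  inn := S.inn
  out := S.out
  bal := S.bal

theorem cut_lift {S : RootedNetwork V} {u v w : V} (hu : u ∈ S.verts) (hv : v ∈ S.verts)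
    (hw : w ∈ S.verts) (A : Finset V) :
    (S.lift u v w).cut A = S.cut A - (if (u ∈ A ↔ v ∈ A) then 0 else 1)
      - (if (v ∈ A ↔ w ∈ A) then 0 else 1) + (if (u ∈ A ↔ w ∈ A) then 0 else 1) := by
  rw [← sum_arc_cut hu hv, ← sum_arc_cut hv hw, ← sum_arc_cut hu hw]
  simp only [cut, lift, Finset.sum_sub_distrib, Finset.sum_add_distrib]
  ring

theorem solvable_of_lift {S : RootedNetwork V} (hS : S.Good k)
    (ih : ∀ S' : RootedNetwork V, S'.Good k → S'.Smaller S → S'.Solvable k)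
    (hslack : S.Slack k) {u v w : V} (hu : u ∈ S.verts) (hv : v ∈ S.verts) (hw : w ∈ S.verts)
    (huv : u ≠ v) (hwv : w ≠ v) (huw : u ≠ w) (hvT : v ∉ S.terms)
    (h1 : 0 < S.mult v u) (h2 : 0 < S.mult v w) : S.Solvable k := by
  have hgood : (S.lift u v w).Good k :=
    { terms_subset := hS.terms_subset
      terms_nonempty := hS.terms_nonempty
      symm := fun a b => by
        have := hS.symm a b
        simp only [lift]
        linarith [arc_comm u v a b, arc_comm v u a b, arc_comm v w a b, arc_comm w v a b,
          arc_comm u w a b, arc_comm w u a b]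
      mult_nonneg := fun a b => by
        have := hS.mult_nonneg a b
        have := hS.symm v u
        have := hS.symm v w
        simp only [lift, arc]
        split_ifs <;> first | omega | (subst_vars; first | omega | contradiction)
      inn_nonneg := hS.inn_nonneg
      out_nonneg := hS.out_nonneg
      parity := fun x hx => by
        rw [cut_lift hu hv hw]
        have := hS.parity x hx
        simp only [lift, Finset.mem_singleton]
        by_cases a1 : u = x <;> by_cases a2 : v = x <;> by_cases a3 : w = x <;>
          simp only [a1, a2, a3, if_true, if_false, iff_true, iff_false, not_true]
            <;> omega
      bal_sum := hS.bal_sum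
      bal_off := hS.bal_off
      root := by
        rw [cut_lift hu hv hw]
        simpa [lift, hu, hv, hw] using hS.root
      le_cut := fun A hA hA' => by
        have := hslack.forall (P := fun A => 2 * k - 2 + circNorm k (∑ x ∈ A, S.bal x)
          + (if (u ∈ A ↔ v ∈ A) then 0 else 1)
          + (if (v ∈ A ↔ w ∈ A) then 0 else 1) - (if (u ∈ A ↔ w ∈ A) then 0 else 1)
            ≤ S.cut A) ?_ ?_ A hA hA'
        · rw [cut_lift hu hv hw]
          simp only [lift]
          linarith
        · intro z hz hz'
          have h3 := hS.le_cut_singleton hz hv (ne_of_mem_of_not_mem hz hvT).symm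
          have h4 : v ≠ z := (ne_of_mem_of_not_mem hz hvT).symm
          simp only [Finset.mem_singleton, Finset.sum_singleton, h4, iff_false, false_iff]
          by_cases a1 : u = z <;> by_cases a3 : w = z <;> simp [a1, a3] <;>
            first | exact h3 | exact absurd (a1.trans a3.symm) huw
        · intro A _ h
          by_cases a1 : u ∈ A <;> by_cases a2 : v ∈ A <;> by_cases a3 : w ∈ A <;>
            simp [a1, a2, a3] <;> omega }
  refine Solvable.of_modification (ih _ hgood ?_) rfl rfl ?_ hS.terms_subset
  · refine Or.inr ⟨rfl, Or.inl ?_⟩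
    simp only [lift, Finset.sum_sub_distrib, Finset.sum_add_distrib, sum_arc, hu, hv, hw, if_true]
    omega
  · intro f hf hf'
    have key : ∀ u w, u ∈ S.verts → w ∈ S.verts → u ≠ v → w ≠ v → u ≠ w → 0 < f u w →
        ∃ g : V → V → ℤ, (∀ a b, 0 ≤ f a b + g a b) ∧
          (∀ a b, g a b = arc u v a b + arc v w a b - arc u w a b) := by
      intro u w hu hw huv hwv huw hpos
      refine ⟨_, fun a b => ?_, fun a b => rfl⟩
      have := hf a b
      simp only [arc]
      split_ifs <;> first | omega | (subst_vars; omega)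
    have hsum : f u w + f w u = S.mult u w + 1 := by
      rw [hf' u hu w hw huw]
      simp [lift, arc, huw, huv, hwv]
    have := hS.mult_nonneg u w
    rcases lt_or_ge 0 (f u w) with hp | hp
    · obtain ⟨g, hg, hg'⟩ := key u w hu hw huv hwv huw hp
      refine ⟨g, hg, fun a _ b _ hab => ?_, fun a ha => ?_⟩
      · simp only [hg', lift]
        linarith [arc_comm u v b a, arc_comm v w b a, arc_comm u w b a]
      · simp [hg', lift, Finset.sum_sub_distrib, Finset.sum_add_distrib, sum_arc_left,
          sum_arc_right, hu, hv, hw]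
    · obtain ⟨g, hg, hg'⟩ := key w u hw hu hwv huv huw.symm (by omega)
      refine ⟨g, hg, fun a _ b _ hab => ?_, fun a ha => ?_⟩
      · simp only [hg', lift]
        linarith [arc_comm w v b a, arc_comm v u b a, arc_comm w u b a]
      · simp [hg', lift, Finset.sum_sub_distrib, Finset.sum_add_distrib, sum_arc_left,
          sum_arc_right, hu, hv, hw]
/-- Delete the vertex `v`. -/
def delete (S : RootedNetwork V) (v : V) : RootedNetwork V where
  verts := S.verts.erase v
  terms := S.terms
  mult := S.mult
  inn := S.inn
  out := S.out
  bal := S.bal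

theorem cut_delete {S : RootedNetwork V} {v : V} (hv : v ∈ S.verts) {A : Finset V} (hvA : v ∉ A) :
    (S.delete v).cut A = S.cut A - ∑ a ∈ A, S.mult a v := by
  have h : ∀ a, ∑ b ∈ S.verts \ A, S.mult a b
      = S.mult a v + ∑ b ∈ S.verts.erase v \ A, S.mult a b := by
    intro a
    rw [Finset.erase_sdiff_comm, Finset.add_sum_erase _ _ (Finset.mem_sdiff.2 ⟨hv, hvA⟩)]
  simp only [cut, delete, h, Finset.sum_add_distrib]
  ring

theorem solvable_of_delete {S : RootedNetwork V} (hS : S.Good k)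
    (ih : ∀ S' : RootedNetwork V, S'.Good k → S'.Smaller S → S'.Solvable k)
    {u v : V} (hu : u ∈ S.verts) (hv : v ∈ S.verts) (huv : u ≠ v) (hvT : v ∉ S.terms)
    (hinn : S.inn v = 0) (hout : S.out v = 0)
    (hnb : ∀ w ∈ S.verts, w ≠ v → w ≠ u → S.mult v w = 0) : S.Solvable k := by
  have hsum : ∀ A : Finset V, A ⊆ S.verts → v ∉ A →
      ∑ a ∈ A, S.mult v a = if u ∈ A then S.mult v u else 0 := by
    intro A hA hvA
    split_ifs with h
    · exact Finset.sum_eq_single_of_mem u h fun w hw hwu =>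
        hnb w (hA hw) (ne_of_mem_of_not_mem hw hvA) hwu
    · exact Finset.sum_eq_zero fun w hw =>
        hnb w (hA hw) (ne_of_mem_of_not_mem hw hvA) (ne_of_mem_of_not_mem hw h)
  have hcutv : S.cut {v} = S.mult v u := by
    rw [cut_singleton, hinn, hout, hsum _ Finset.sdiff_subset (by simp)]
    simp [hu, huv]
  have hbal := hS.bal_off v hv hvT
  have hbal2 : 2 ∣ S.bal v := (Dvd.intro _ rfl).trans hbal
  have heven : 2 ∣ S.mult v u := by
    have := hS.parity v hv
    omega
  have hcut : ∀ A : Finset V, A ⊆ S.verts → v ∉ A →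
      (S.delete v).cut A = S.cut A - if u ∈ A then S.mult v u else 0 := by
    intro A hA hvA
    rw [cut_delete hv hvA, ← hsum A hA hvA]
    simp only [hS.symm v]
  have hlecut : ∀ A, A ⊂ S.verts.erase v → (A ∩ S.terms).Nonempty →
      2 * k - 2 + circNorm k (∑ x ∈ A, S.bal x) ≤ (S.delete v).cut A := by
    intro A hA hA'
    have hvA : v ∉ A := fun h => Finset.notMem_erase v _ (hA.1 h)
    have hAW : A ⊆ S.verts := hA.1.trans (Finset.erase_subset v _)
    rw [hcut A hAW hvA]
    split_ifs with h
    · have hss : A ∪ {v} ⊂ S.verts := by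
        obtain ⟨x, hx, hxA⟩ := Finset.exists_of_ssubset hA
        rw [Finset.mem_erase] at hx
        exact (Finset.ssubset_iff_of_subset (Finset.union_subset hAW
          (Finset.singleton_subset_iff.2 hv))).2 ⟨x, hx.2, by simp [hxA, hx.1]⟩
      have h1 := hS.le_cut (A ∪ {v}) hss
        (hA'.mono (Finset.inter_subset_inter_right Finset.subset_union_left))
      have hdis : Disjoint A {v} := Finset.disjoint_singleton_right.2 hvA
      rw [cut_union hS.symm hdis hAW (Finset.singleton_subset_iff.2 hv), hcutv,
        Finset.sum_union hdis, Finset.sum_singleton,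
        circNorm_congr (b := ∑ x ∈ A, S.bal x) (by rwa [add_sub_cancel_left])] at h1
      simp only [Finset.sum_singleton, hS.symm _ v, hsum A hAW hvA, h, if_true] at h1
      linarith
    · rw [sub_zero]
      exact hS.le_cut A (lt_of_lt_of_le hA (Finset.erase_subset v _)) hA'
  have hgood : (S.delete v).Good k :=
    { terms_subset := fun t ht => Finset.mem_erase.2
        ⟨ne_of_mem_of_not_mem ht hvT, hS.terms_subset ht⟩
      terms_nonempty := hS.terms_nonempty
      symm := hS.symm
      mult_nonneg := hS.mult_nonneg
      inn_nonneg := hS.inn_nonneg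
      out_nonneg := hS.out_nonneg
      parity := fun x hx => by
        obtain ⟨hxv, hx⟩ := Finset.mem_erase.1 hx
        rw [hcut {x} (Finset.singleton_subset_iff.2 hx) (by simpa using hxv.symm)]
        have := hS.parity x hx
        simp only [delete]
        split_ifs <;> omega
      bal_sum := by
        have := hS.bal_sum
        rw [← Finset.add_sum_erase _ _ hv, ← Finset.add_sum_erase _ _ hv, hinn, hout, sub_self,
          zero_add, add_sub_assoc] at this
        exact (Int.dvd_add_right hbal).1 this
      bal_off := fun x hx => hS.bal_off x (Finset.mem_of_mem_erase hx)
      root := by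
        have h1 := hS.root
        rw [cut_verts, ← Finset.add_sum_erase _ _ hv, hinn, hout, add_zero, zero_add,
          ← Finset.add_sum_erase _ S.bal hv,
          circNorm_congr (b := ∑ x ∈ S.verts.erase v, S.bal x)
            (by rwa [add_sub_cancel_right])] at h1
        rw [cut_verts]
        exact h1
      le_cut := hlecut }
  obtain ⟨f, h1, h2, h3, h4⟩ := ih _ hgood (Or.inl (Finset.card_erase_lt_of_mem hv))
  have hnet : ∀ x ∈ S.verts, S.net (fun a b => if a = v ∨ b = v then S.mult a b / 2 else f a b) x
      = if x = v then 0 else (S.delete v).net f x := by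
    intro x hx
    simp only [net, delete]
    rw [← Finset.add_sum_erase _ _ hv]
    by_cases h : x = v
    · subst h
      simp [hinn, hout, hS.symm x]
    · rw [if_neg h, Finset.sum_congr rfl (g := fun y => f x y - f y x)]
      · simp [hS.symm x v]
      · intro y hy
        simp [h, (Finset.mem_erase.1 hy).1]
  have hev : ∀ b ∈ S.verts, b ≠ v → S.mult v b / 2 + S.mult v b / 2 = S.mult v b := by
    intro b hb hbv
    by_cases hbu : b = u
    · subst hbu
      omega
    · rw [hnb b hb hbv hbu]
      rfl
  refine ⟨fun a b => if a = v ∨ b = v then S.mult a b / 2 else f a b, fun a b => ?_,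
    fun a ha b hb hab => ?_, fun x hx => ?_, fun x hx hx' => ?_⟩
  rotate_left 2
  · rw [hnet x (hS.terms_subset hx), if_neg (ne_of_mem_of_not_mem hx hvT)]
    exact h3 x hx
  · rw [hnet x hx]
    split_ifs with h
    · rfl
    · exact h4 x (Finset.mem_erase.2 ⟨h, hx⟩) hx'
  · dsimp only
    split_ifs
    · exact Int.ediv_nonneg (hS.mult_nonneg a b) (by norm_num)
    · exact h1 a b
  · by_cases ha' : a = v
    · subst ha'
      simp only [true_or, or_true, if_true]
      rw [hS.symm b a]
      exact hev b hb hab.symm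
    · by_cases hb' : b = v
      · subst hb'
        simp only [true_or, or_true, if_true]
        rw [hS.symm a b]
        exact hev a ha hab
      · simp only [ha', hb', or_self, if_false]
        exact h2 a (Finset.mem_erase.2 ⟨ha', ha⟩) b (Finset.mem_erase.2 ⟨hb', hb⟩) hab

theorem solvable_of_mem_of_notMem_terms {S : RootedNetwork V} (hk : 0 < k) (hS : S.Good k)
    (ih : ∀ S' : RootedNetwork V, S'.Good k → S'.Smaller S → S'.Solvable k)
    (hslack : S.Slack k) {v : V} (hv : v ∈ S.verts) (hvT : v ∉ S.terms) : S.Solvable k := by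
  rcases (hS.inn_nonneg v).lt_or_eq with hinn | hinn
  · exact solvable_of_inn_pos hS ih hslack hv hvT hinn
  rcases (hS.out_nonneg v).lt_or_eq with hout | hout
  · exact solvable_of_out_pos hk hS ih hslack hv hvT hout
  have hnb : ∀ w, S.mult v w ≠ 0 → 0 < S.mult v w := fun w h =>
    lt_of_le_of_ne (hS.mult_nonneg v w) h.symm
  by_cases h : ∃ u ∈ S.verts, u ≠ v ∧ S.mult v u ≠ 0
  · obtain ⟨u, hu, huv, hm⟩ := h
    by_cases h' : ∃ w ∈ S.verts, w ≠ v ∧ w ≠ u ∧ S.mult v w ≠ 0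
    · obtain ⟨w, hw, hwv, hwu, hm'⟩ := h'
      exact solvable_of_lift hS ih hslack hu hv hw huv hwv hwu.symm hvT (hnb u hm) (hnb w hm')
    · push Not at h'
      exact solvable_of_delete hS ih hu hv huv hvT hinn.symm hout.symm h'
  · push Not at h
    obtain ⟨t, ht⟩ := hS.terms_nonempty
    exact solvable_of_delete hS ih (hS.terms_subset ht) hv (ne_of_mem_of_not_mem ht hvT) hvT
      hinn.symm hout.symm fun w hw hwv _ => h w hw hwv
/-- Remove `x` from the terminals. -/
def eraseTerm (S : RootedNetwork V) (x : V) : RootedNetwork V where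
  verts := S.verts
  terms := S.terms.erase x
  mult := S.mult
  inn := S.inn
  out := S.out
  bal := S.bal

theorem solvable_of_circNorm_eq_zero {S : RootedNetwork V} (hk : 0 < k) (hS : S.Good k)
    (ih : ∀ S' : RootedNetwork V, S'.Good k → S'.Smaller S → S'.Solvable k) {x y : V}
    (hx : x ∈ S.terms) (hy : y ∈ S.terms) (hyx : y ≠ x) (h : circNorm k (S.bal x) = 0) :
    S.Solvable k := by
  have hdvd := dvd_of_circNorm_eq_zero hk h
  have hgood : (S.eraseTerm x).Good k :=
    { hS with
      terms_subset := (Finset.erase_subset _ _).trans hS.terms_subset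
      terms_nonempty := ⟨y, Finset.mem_erase.2 ⟨hyx, hy⟩⟩
      bal_off := fun v hv hv' => by
        by_cases hvx : v = x
        · exact hvx ▸ hdvd
        · exact hS.bal_off v hv fun h => hv' (Finset.mem_erase.2 ⟨hvx, h⟩)
      le_cut := fun A hA hA' => hS.le_cut A hA
        (hA'.mono (Finset.inter_subset_inter_left (Finset.erase_subset _ _))) }
  obtain ⟨f, h1, h2, h3, h4⟩ := ih _ hgood (Or.inr ⟨rfl, Or.inr ⟨rfl, by
    have : (S.terms.erase x).card < S.terms.card := Finset.card_erase_lt_of_mem hx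
    have h5 : (S.eraseTerm x).cut S.verts = S.cut S.verts := rfl
    change (S.eraseTerm x).cut S.verts + (S.terms.erase x).card < _
    omega⟩⟩)
  refine ⟨f, h1, h2, fun v hv => ?_, fun v hv hv' =>
    h4 v hv fun h => hv' (Finset.mem_of_mem_erase h)⟩
  by_cases hvx : v = x
  · subst hvx
    have h5 : S.net f v = 0 := h4 v (hS.terms_subset hv) (Finset.notMem_erase _ _)
    rw [h5, zero_sub]
    exact Int.dvd_neg.2 hdvd
  · exact h3 v (Finset.mem_erase.2 ⟨hvx, hv⟩)

theorem Good.exists_mult_pos_of_ssubset {S : RootedNetwork V} (hk : 1 < k) (hS : S.Good k)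
    (hT : S.terms = S.verts) {P : Finset V} (hP : P ⊂ S.verts) (hP' : P.Nonempty) :
    ∃ x ∈ P, ∃ y ∈ S.verts, y ∉ P ∧ 0 < S.mult x y := by
  by_contra! hcon
  have h0 : ∑ u ∈ P, ∑ v ∈ S.verts \ P, S.mult u v = 0 :=
    Finset.sum_eq_zero fun u hu => Finset.sum_eq_zero fun v hv =>
      le_antisymm (hcon u hu v (Finset.mem_sdiff.1 hv).1 (Finset.mem_sdiff.1 hv).2)
        (hS.mult_nonneg u v)
  have h1 := hS.le_cut P hP (by rwa [hT, Finset.inter_eq_left.2 hP.1])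
  have hQ : S.verts \ P ⊂ S.verts := Finset.sdiff_ssubset hP.1 hP'
  have h2 := hS.le_cut _ hQ (by
    rw [hT, Finset.inter_eq_left.2 Finset.sdiff_subset]
    exact Finset.sdiff_nonempty.2 hP.2)
  have h3 := cut_union hS.symm Finset.disjoint_sdiff hP.1 (Finset.sdiff_subset (t := P))
  rw [h0, Finset.union_sdiff_of_subset hP.1] at h3
  have h4 := hS.root
  have h5 := circNorm_add_le (k := k) (by omega) (∑ v ∈ P, S.bal v) (∑ v ∈ S.verts \ P, S.bal v)
  rw [add_comm (∑ v ∈ P, S.bal v), Finset.sum_sdiff hP.1] at h5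
  omega

theorem solvable_of_pred {S : RootedNetwork V} (hk : 0 < k) (hS : S.Good k)
    (ih : ∀ S' : RootedNetwork V, S'.Good k → S'.Smaller S → S'.Solvable k)
    (hslack : S.Slack k) (hT : S.terms = S.verts) {x y : V} (hx : x ∈ S.verts) (hy : y ∈ S.verts)
    (hxy : x ≠ y) (hm : 0 < S.mult x y) (hpos : circNorm k (S.bal x - 1) = circNorm k (S.bal x) - 1)
    (hroot : S.cut S.verts + 1 ≤ 2 * k - 2 + circNorm k (∑ v ∈ S.verts, S.bal v - 1)) :
    S.Solvable k := by
  refine solvable_of_removeEdge hS ih hx hy hxy hm (fun v => if v = y then 1 else 0) (fun _ => 0)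
    (fun v => ?_) (fun v => by simpa using hS.out_nonneg v) (fun v hv hv' => absurd hv (hT ▸ hv'))
    ?_ ?_
  · have := hS.inn_nonneg v
    split_ifs <;> omega
  · simpa [hy, ← sub_eq_add_neg] using hroot
  · simp only [add_zero, zero_sub, Finset.sum_neg_distrib, Finset.sum_ite_eq']
    refine hslack.forall ?_ ?_
    · intro z hz hz'
      by_cases h1 : x = z
      · subst h1
        have := hS.le_cut_singleton hz hy hxy.symm
        simp [hxy.symm]
        omega
      · have := hS.le_cut_singleton hz hx h1
        by_cases h2 : y = z <;> simp [h1, h2] <;> omega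
    · intro A _ h
      have := circNorm_pred hk (∑ v ∈ A, S.bal v)
      by_cases h1 : x ∈ A <;> by_cases h2 : y ∈ A <;> simp [h1, h2, ← sub_eq_add_neg] <;>
        omega

/-- Delete an edge from the root to `x`. -/
def eraseInn (S : RootedNetwork V) (x : V) : RootedNetwork V where
  verts := S.verts
  terms := S.terms
  mult := S.mult
  inn v := S.inn v - if v = x then 1 else 0
  out := S.out
  bal v := S.bal v + if v = x then 1 else 0

theorem cut_eraseInn (S : RootedNetwork V) (x : V) (A : Finset V) :
    (S.eraseInn x).cut A = S.cut A - if x ∈ A then 1 else 0 := by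
  simp only [cut, eraseInn, Finset.sum_add_distrib, Finset.sum_sub_distrib, Finset.sum_ite_eq']
  ring

theorem sum_bal_eraseInn (S : RootedNetwork V) (x : V) (A : Finset V) :
    ∑ v ∈ A, (S.eraseInn x).bal v = ∑ v ∈ A, S.bal v + if x ∈ A then 1 else 0 := by
  simp only [eraseInn, Finset.sum_add_distrib, Finset.sum_ite_eq']

theorem solvable_of_inn_pos_of_succ {S : RootedNetwork V} (hk : 0 < k) (hS : S.Good k)
    (ih : ∀ S' : RootedNetwork V, S'.Good k → S'.Smaller S → S'.Solvable k)
    (hslack : S.Slack k) (hT : S.terms = S.verts) (hc : 1 < S.verts.card) {x : V}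
    (hx : x ∈ S.verts) (hinn : 0 < S.inn x)
    (hneg : circNorm k (S.bal x + 1) = circNorm k (S.bal x) - 1) : S.Solvable k := by
  obtain ⟨y, hy, hyx⟩ := Finset.exists_mem_ne hc x
  have hgood : (S.eraseInn x).Good k :=
    { hS with
      inn_nonneg := fun v => by
        have := hS.inn_nonneg v
        simp only [eraseInn]
        split_ifs with h
        · subst h
          omega
        · omega
      parity := fun v hv => by
        rw [cut_eraseInn]
        have := hS.parity v hv
        simp only [eraseInn, Finset.mem_singleton, @eq_comm _ v]
        split_ifs <;> omega
      bal_sum := by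
        convert hS.bal_sum using 1
        simp only [eraseInn, Finset.sum_add_distrib, Finset.sum_sub_distrib, Finset.sum_ite_eq']
        ring
      bal_off := fun v hv hv' => absurd hv (hT ▸ hv')
      root := by
        have := hS.root
        have := circNorm_succ hk (∑ v ∈ S.verts, S.bal v)
        rw [cut_eraseInn, sum_bal_eraseInn]
        simp only [eraseInn, hx, if_true]
        omega
      le_cut := by
        simp only [cut_eraseInn, sum_bal_eraseInn]
        refine hslack.forall ?_ ?_
        · intro z hz hz'
          by_cases h1 : x = z
          · subst h1
            have := hS.le_cut_singleton hz hy hyx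
            simp
            omega
          · have := hS.le_cut_singleton hz hx h1
            simpa [h1] using this
        · intro A _ h
          have := circNorm_succ hk (∑ v ∈ A, S.bal v)
          split_ifs
          · omega
          · rw [add_zero]
            omega }
  refine Solvable.of_modification (ih _ hgood (Or.inr ⟨rfl, Or.inr ⟨rfl, ?_⟩⟩)) rfl rfl
    (fun f hf _ => ⟨fun _ _ => 0, fun u v => by simpa using hf u v,
      fun u _ v _ _ => by simp [eraseInn], fun v hv => ?_⟩) hS.terms_subset
  · have h5 : (S.eraseInn x).cut S.verts = S.cut S.verts - 1 := by
      rw [cut_eraseInn, if_pos hx]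
    change (S.eraseInn x).cut S.verts + S.terms.card < _
    omega
  · simp [eraseInn, hT, hv]
theorem solvable_of_pred_of_succ {S : RootedNetwork V} (hk : 0 < k) (hS : S.Good k)
    (ih : ∀ S' : RootedNetwork V, S'.Good k → S'.Smaller S → S'.Solvable k)
    (hslack : S.Slack k) (hT : S.terms = S.verts) {x y : V} (hx : x ∈ S.verts) (hy : y ∈ S.verts)
    (hxy : x ≠ y) (hm : 0 < S.mult x y) (hpos : circNorm k (S.bal x - 1) = circNorm k (S.bal x) - 1)
    (hneg : circNorm k (S.bal y + 1) = circNorm k (S.bal y) - 1) : S.Solvable k := by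
  refine solvable_of_removeEdge hS ih hx hy hxy hm (fun _ => 0) (fun _ => 0)
    (fun v => by simpa using hS.inn_nonneg v) (fun v => by simpa using hS.out_nonneg v)
    (fun v hv hv' => absurd hv (hT ▸ hv')) (by simpa using hS.root) ?_
  simp only [add_zero, sub_zero, Finset.sum_const_zero]
  refine hslack.forall ?_ ?_
  · intro z hz hz'
    by_cases h1 : x = z
    · subst h1
      have := hS.le_cut_singleton hz hy hxy.symm
      simp [hxy.symm]
      omega
    · have := hS.le_cut_singleton hz hx h1
      by_cases h2 : y = z
      · subst h2
        simp [hxy]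
        omega
      · simpa [h1, h2] using this
  · intro A _ h
    have := circNorm_pred hk (∑ v ∈ A, S.bal v)
    have := circNorm_succ hk (∑ v ∈ A, S.bal v)
    by_cases h1 : x ∈ A <;> by_cases h2 : y ∈ A <;> simp [h1, h2] <;> omega

theorem solvable_of_cut_eq {S : RootedNetwork V} (hk : 0 < k) (hS : S.Good k)
    (ih : ∀ S' : RootedNetwork V, S'.Good k → S'.Smaller S → S'.Solvable k)
    (hslack : S.Slack k) (hT : S.terms = S.verts) {x y : V} (hx : x ∈ S.verts) (hy : y ∈ S.verts)
    (hxy : x ≠ y) (hm : 0 < S.mult x y) (hx0 : 0 < circNorm k (S.bal x))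
    (hneg : (2 * k : ℤ) ∣ S.bal x + circNorm k (S.bal x))
    (hneg' : circNorm k (S.bal y + 1) = circNorm k (S.bal y) - 1)
    (hD : S.cut S.verts = 2 * k - 1) (hsum : (2 * k : ℤ) ∣ ∑ v ∈ S.verts, S.bal v + 1) :
    S.Solvable k := by
  have hle := circNorm_le hk (S.bal x)
  refine solvable_of_removeEdge hS ih hx hy hxy hm
    (fun v => if v = x then k - circNorm k (S.bal x) else 0) (fun _ => 0)
    (fun v => ?_) (fun v => by simpa using hS.out_nonneg v)
    (fun v hv hv' => absurd hv (hT ▸ hv')) ?_ ?_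
  · have := hS.inn_nonneg v
    split_ifs <;> omega
  · simp only [add_zero, zero_sub, Finset.sum_neg_distrib, Finset.sum_ite_eq', hx, if_true]
    rw [circNorm_eq hk (n := ∑ v ∈ S.verts, S.bal v + -(k - circNorm k (S.bal x)))
        (r := -(1 + k - circNorm k (S.bal x))) (by convert hsum using 1; ring)
      (by rw [abs_neg, abs_le]; omega), abs_neg, abs_of_nonneg (by omega), hD]
    omega
  · simp only [add_zero, zero_sub, Finset.sum_neg_distrib, Finset.sum_ite_eq']
    refine hslack.forall ?_ ?_
    · intro z hz hz'
      by_cases h1 : x = z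
      · subst h1
        have := hS.le_cut_singleton hz hy hxy.symm
        have := circNorm_eq hk (n := S.bal x - 1 + (circNorm k (S.bal x) - k)) (r := k - 1)
          (by
            obtain ⟨c, hc⟩ := hneg
            exact ⟨c - 1, by linarith⟩) (by rw [abs_le]; omega)
        rw [abs_of_nonneg (by omega)] at this
        simp [hxy.symm]
        omega
      · have := hS.le_cut_singleton hz hx h1
        by_cases h2 : y = z
        · subst h2
          simp [hxy]
          omega
        · simpa [h1, h2, Ne.symm h1] using this
    · intro A _ h
      have h3 := circNorm_add_le_abs hk (∑ v ∈ A, S.bal v) (-1 - (k - circNorm k (S.bal x)))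
      have h4 := circNorm_add_le_abs hk (∑ v ∈ A, S.bal v) (-(k - circNorm k (S.bal x)))
      have h5 := circNorm_succ hk (∑ v ∈ A, S.bal v)
      rw [abs_of_nonpos (by omega)] at h3 h4
      by_cases h1 : x ∈ A <;> by_cases h2 : y ∈ A <;> simp [h1, h2]
      · rw [neg_sub] at h4
        omega
      · rw [← add_sub_assoc, ← sub_eq_add_neg, sub_eq_add_neg, neg_sub] at h3
        omega
      · omega
      · omega
theorem solvable_of_forall_succ {S : RootedNetwork V} (hk : 1 < k) (hS : S.Good k)
    (ih : ∀ S' : RootedNetwork V, S'.Good k → S'.Smaller S → S'.Solvable k)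
    (hslack : S.Slack k) (hT : S.terms = S.verts) (hc : 1 < S.verts.card)
    (h0 : ∀ x ∈ S.verts, circNorm k (S.bal x) ≠ 0)
    (hpred : ∀ x ∈ S.verts, circNorm k (S.bal x - 1) = circNorm k (S.bal x) + 1)
    (hinn : ∀ x ∈ S.verts, S.inn x = 0)
    (hD : S.cut S.verts = 2 * k - 2 + circNorm k (∑ v ∈ S.verts, S.bal v))
    (hs0 : circNorm k (∑ v ∈ S.verts, S.bal v) ≠ 0)
    (hs : circNorm k (∑ v ∈ S.verts, S.bal v - 1) = circNorm k (∑ v ∈ S.verts, S.bal v) + 1) :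
    S.Solvable k := by
  have hk0 : 0 < k := by omega
  have h1 := dvd_add_circNorm hk0 hs
  have h2 := hS.bal_sum
  have h3 : ∑ v ∈ S.verts, (S.out v - S.inn v) = S.cut S.verts := by
    rw [cut_verts]
    refine Finset.sum_congr rfl fun v hv => ?_
    rw [hinn v hv]
    ring
  have h4 := circNorm_le hk0 (∑ v ∈ S.verts, S.bal v)
  have h5 := circNorm_nonneg (k := k) (∑ v ∈ S.verts, S.bal v)
  have h6 : circNorm k (∑ v ∈ S.verts, S.bal v) = 1 := by
    have h7 : (2 * k : ℤ) ∣ 2 * circNorm k (∑ v ∈ S.verts, S.bal v) - 2 := by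
      rw [h3, hD] at h2
      obtain ⟨a, ha⟩ := h1
      obtain ⟨b, hb⟩ := h2
      exact ⟨a - b - 1, by linarith⟩
    have := Int.eq_zero_of_dvd_of_nonneg_of_lt (by omega) (by omega) h7
    omega
  rw [h6] at h1 hD
  obtain ⟨x, hx⟩ : S.verts.Nonempty := Finset.card_pos.1 (by omega)
  obtain ⟨z, hz, hzx⟩ := Finset.exists_mem_ne hc x
  obtain ⟨x', hx', y, hy, hyx, hm⟩ := hS.exists_mult_pos_of_ssubset hk hT
    ((Finset.ssubset_iff_of_subset (Finset.singleton_subset_iff.2 hx)).2 ⟨z, hz, by simpa using hzx⟩)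
    (Finset.singleton_nonempty x)
  rw [Finset.mem_singleton] at hx' hyx
  subst hx'
  have := circNorm_nonneg (k := k) (S.bal x')
  have := h0 x' hx
  refine solvable_of_cut_eq hk0 hS ih hslack hT hx hy (Ne.symm hyx) hm (by omega)
    (dvd_add_circNorm hk0 (hpred x' hx)) ?_ (by omega) h1
  refine (circNorm_pred_or_succ hk0 (h0 y hy)).resolve_left fun h => ?_
  have := hpred y hy
  omega

theorem solvable_of_terms_eq_verts {S : RootedNetwork V} (hk : 1 < k) (hS : S.Good k)
    (ih : ∀ S' : RootedNetwork V, S'.Good k → S'.Smaller S → S'.Solvable k)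
    (hslack : S.Slack k) (hT : S.terms = S.verts) (hc : 1 < S.verts.card) : S.Solvable k := by
  have hk0 : 0 < k := by omega
  by_cases h0 : ∃ x ∈ S.terms, circNorm k (S.bal x) = 0
  · obtain ⟨x, hx, h⟩ := h0
    obtain ⟨y, hy, hyx⟩ := Finset.exists_mem_ne hc x
    exact solvable_of_circNorm_eq_zero hk0 hS ih hx (hT ▸ hy) hyx h
  push Not at h0
  rw [hT] at h0
  have ihr : ∀ S' : RootedNetwork V, S'.Good k → S'.Smaller S.rev → S'.Solvable k :=
    fun _ h1 h2 => ih _ h1 h2.of_rev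
  have hrev : ∀ n : ℤ, circNorm k (-n - 1) = circNorm k (n + 1) := fun n => by
    rw [← circNorm_neg hk0]
    ring_nf
  have hrev' : ∀ n : ℤ, circNorm k (-n + 1) = circNorm k (n - 1) := fun n => by
    rw [← circNorm_neg hk0]
    ring_nf
  have hss : ∀ x ∈ S.verts, ({x} : Finset V) ⊂ S.verts := fun x hx => by
    obtain ⟨y, hy, hyx⟩ := Finset.exists_mem_ne hc x
    exact (Finset.ssubset_iff_of_subset (Finset.singleton_subset_iff.2 hx)).2
      ⟨y, hy, by simpa using hyx⟩
  have hadj : ∀ x ∈ S.verts, ∃ y ∈ S.verts, x ≠ y ∧ 0 < S.mult x y := by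
    intro x hx
    obtain ⟨x', hx', y, hy, hyx, hm⟩ :=
      hS.exists_mult_pos_of_ssubset hk hT (hss x hx) (Finset.singleton_nonempty x)
    rw [Finset.mem_singleton] at hx' hyx
    subst hx'
    exact ⟨y, hy, Ne.symm hyx, hm⟩
  by_contra hcon
  set s := ∑ v ∈ S.verts, S.bal v with hs
  have hsr : ∑ v ∈ S.verts, S.rev.bal v = -s := by
    simp [RootedNetwork.rev, hs]
  have hpos : ∀ x ∈ S.verts, circNorm k (S.bal x - 1) = circNorm k (S.bal x) - 1 →
      2 * k - 2 + circNorm k (s - 1) < S.cut S.verts + 1 := by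
    intro x hx h
    obtain ⟨y, hy, hxy, hm⟩ := hadj x hx
    exact not_le.1 fun hroot => hcon (solvable_of_pred hk0 hS ih hslack hT hx hy hxy hm h hroot)
  have hneg : ∀ x ∈ S.verts, circNorm k (S.bal x + 1) = circNorm k (S.bal x) - 1 →
      2 * k - 2 + circNorm k (s + 1) < S.cut S.verts + 1 := by
    intro x hx h
    obtain ⟨y, hy, hxy, hm⟩ := hadj x hx
    refine not_le.1 fun hroot => hcon (Solvable.of_rev
      (solvable_of_pred hk0 (hS.rev hk0) ihr (Slack.rev hk0 hslack) hT hx hy hxy hm ?_ ?_))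
    · change circNorm k (-S.bal x - 1) = circNorm k (-S.bal x) - 1
      rwa [hrev, circNorm_neg hk0]
    · rw [show S.rev.verts = S.verts from rfl, hsr, cut_rev, hrev]
      exact hroot
  have hinn : ∀ x ∈ S.verts, 0 < S.inn x →
      circNorm k (S.bal x + 1) = circNorm k (S.bal x) + 1 := by
    intro x hx h
    exact (circNorm_succ hk0 _).resolve_right fun h' =>
      hcon (solvable_of_inn_pos_of_succ hk0 hS ih hslack hT hc hx h h')
  have hout : ∀ x ∈ S.verts, 0 < S.out x →
      circNorm k (S.bal x - 1) = circNorm k (S.bal x) + 1 := by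
    intro x hx h
    refine (circNorm_pred hk0 _).resolve_right fun h' => hcon (Solvable.of_rev
      (solvable_of_inn_pos_of_succ hk0 (hS.rev hk0) ihr (Slack.rev hk0 hslack) hT hc hx h ?_))
    change circNorm k (-S.bal x + 1) = circNorm k (-S.bal x) - 1
    rwa [hrev', circNorm_neg hk0]
  have hroot := hS.root
  rw [← hs] at hroot
  have hpar := two_dvd_cut_sub hS.symm hS.parity (Finset.Subset.refl S.verts)
  rw [← hs] at hpar
  have hpar' := two_dvd_circNorm_sub hk0 s
  have hsucc := circNorm_succ hk0 s
  have hpred := circNorm_pred hk0 s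
  have hs0 : circNorm k s ≠ 0 := fun h => by
    have := circNorm_nonneg (k := k) (s + 1)
    have := circNorm_nonneg (k := k) (s - 1)
    obtain ⟨x, hx⟩ : S.verts.Nonempty := Finset.card_pos.1 (by omega)
    rcases circNorm_pred_or_succ hk0 (h0 x hx) with h' | h'
    · have := hpos x hx h'
      omega
    · have := hneg x hx h'
      omega
  have hD : S.cut S.verts = 2 * k - 2 + circNorm k s := by
    obtain ⟨x, hx⟩ : S.verts.Nonempty := Finset.card_pos.1 (by omega)
    rcases circNorm_pred_or_succ hk0 (h0 x hx) with h' | h'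
    · have := hpos x hx h'
      omega
    · have := hneg x hx h'
      omega
  rcases hpred with hpred | hpred
  · have hall : ∀ x ∈ S.verts, circNorm k (S.bal x - 1) = circNorm k (S.bal x) + 1 :=
      fun x hx => (circNorm_pred hk0 _).resolve_right fun h => by
        have := hpos x hx h
        omega
    refine hcon (solvable_of_forall_succ hk hS ih hslack hT hc h0 hall (fun x hx => ?_) hD hs0 hpred)
    refine le_antisymm (not_lt.1 fun h => ?_) (hS.inn_nonneg x)
    have := hinn x hx h
    have := hall x hx
    have := circNorm_pred_or_succ hk0 (h0 x hx)
    omega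
  rcases hsucc with hsucc | hsucc
  · have hall : ∀ x ∈ S.verts, circNorm k (S.bal x + 1) = circNorm k (S.bal x) + 1 :=
      fun x hx => (circNorm_succ hk0 _).resolve_right fun h => by
        have := hneg x hx h
        omega
    refine hcon (Solvable.of_rev (solvable_of_forall_succ hk (hS.rev hk0) ihr
      (Slack.rev hk0 hslack) hT hc (fun x hx => ?_) (fun x hx => ?_) (fun x hx => ?_) ?_ ?_ ?_))
    · rw [show S.rev.bal x = -S.bal x from rfl, circNorm_neg hk0]
      exact h0 x hx
    · rw [show S.rev.bal x = -S.bal x from rfl, circNorm_neg hk0, hrev]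
      exact hall x hx
    · refine le_antisymm (not_lt.1 fun h => ?_) (hS.out_nonneg x)
      have := hout x hx h
      have := hall x hx
      have := circNorm_pred_or_succ hk0 (h0 x hx)
      omega
    · rwa [show S.rev.verts = S.verts from rfl, hsr, circNorm_neg hk0, cut_rev]
    · rwa [show S.rev.verts = S.verts from rfl, hsr, circNorm_neg hk0]
    · rwa [show S.rev.verts = S.verts from rfl, hsr, circNorm_neg hk0, hrev]
  have hsk := circNorm_eq_of_pred_of_succ hk0 hpred hsucc
  have hsum : circNorm k (∑ v ∈ S.verts, (S.out v - S.inn v)) = k := by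
    rw [← hsk]
    exact (circNorm_congr hS.bal_sum).symm
  have hDn : circNorm k (S.cut S.verts) = k - 2 := by
    rw [hD, hsk, circNorm_eq hk0 (r := k - 2) ⟨1, by ring⟩ (by rw [abs_le]; omega),
      abs_of_nonneg (by omega)]
  rw [cut_verts] at hDn
  obtain ⟨x, hx, hxi⟩ : ∃ x ∈ S.verts, 0 < S.inn x := by
    by_contra! h
    have : ∑ v ∈ S.verts, (S.out v - S.inn v) = ∑ v ∈ S.verts, (S.inn v + S.out v) :=
      Finset.sum_congr rfl fun v hv => by linarith [h v hv, hS.inn_nonneg v]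
    rw [this] at hsum
    omega
  obtain ⟨y, hy, hyo⟩ : ∃ y ∈ S.verts, 0 < S.out y := by
    by_contra! h
    have : ∑ v ∈ S.verts, (S.out v - S.inn v) = -∑ v ∈ S.verts, (S.inn v + S.out v) := by
      rw [← Finset.sum_neg_distrib]
      exact Finset.sum_congr rfl fun v hv => by linarith [h v hv, hS.out_nonneg v]
    rw [this, circNorm_neg hk0] at hsum
    omega
  obtain ⟨a, ha, b, hb, hba, hm⟩ := hS.exists_mult_pos_of_ssubset hk hT
    (P := S.verts.filter fun v => circNorm k (S.bal v - 1) = circNorm k (S.bal v) - 1)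
    ((Finset.ssubset_iff_of_subset (Finset.filter_subset _ _)).2 ⟨y, hy, fun h => by
      have := (Finset.mem_filter.1 h).2
      have := hout y hy hyo
      omega⟩)
    ⟨x, Finset.mem_filter.2 ⟨hx, (circNorm_pred_or_succ hk0 (h0 x hx)).resolve_right fun h => by
      have := hinn x hx hxi
      omega⟩⟩
  have hb' : ¬circNorm k (S.bal b - 1) = circNorm k (S.bal b) - 1 := fun h =>
    hba (Finset.mem_filter.2 ⟨hb, h⟩)
  exact hcon (solvable_of_pred_of_succ hk0 hS ih hslack hT (Finset.mem_filter.1 ha).1 hb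
    (ne_of_mem_of_not_mem ha hba) hm (Finset.mem_filter.1 ha).2
    ((circNorm_pred_or_succ hk0 (h0 b hb)).resolve_left hb'))
/-- Identify vertices along the map `π`. -/
def map (S : RootedNetwork V) (π : V → V) : RootedNetwork V where
  verts := S.verts.image π
  terms := S.terms.image π
  mult x y := ∑ u ∈ S.verts with π u = x, ∑ v ∈ S.verts with π v = y, S.mult u v
  inn x := ∑ u ∈ S.verts with π u = x, S.inn u
  out x := ∑ u ∈ S.verts with π u = x, S.out u
  bal x := ∑ u ∈ S.verts with π u = x, S.bal u

theorem cut_map (S : RootedNetwork V) (π : V → V) (B : Finset V) :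
    (S.map π).cut B = S.cut {u ∈ S.verts | π u ∈ B} := by
  have h : S.verts \ {u ∈ S.verts | π u ∈ B} = {u ∈ S.verts | π u ∈ S.verts.image π \ B} := by
    ext u
    simp only [Finset.mem_sdiff, Finset.mem_filter, Finset.mem_image]
    exact ⟨fun ⟨h1, h2⟩ => ⟨h1, ⟨u, h1, rfl⟩, fun h3 => h2 ⟨h1, h3⟩⟩,
      fun ⟨h1, h2⟩ => ⟨h1, fun h3 => h2.2 h3.2⟩⟩
  simp only [cut, map, h, ← Finset.sum_fiberwise_eq_sum_filter, Finset.sum_add_distrib]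
  congr 1
  refine Finset.sum_congr rfl fun x _ => ?_
  rw [Finset.sum_comm]

theorem Good.map {S : RootedNetwork V} (hS : S.Good k) (π : V → V) : (S.map π).Good k := by
  have hall : ∀ f : V → ℤ,
      ∑ x ∈ S.verts.image π, ∑ u ∈ S.verts with π u = x, f u = ∑ u ∈ S.verts, f u := fun f =>
    Finset.sum_fiberwise_of_maps_to (fun u hu => Finset.mem_image_of_mem π hu) f
  have himg : {u ∈ S.verts | π u ∈ S.verts.image π} = S.verts :=
    Finset.filter_true_of_mem fun u hu => Finset.mem_image_of_mem π hu
  exact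
    { terms_subset := Finset.image_subset_image hS.terms_subset
      terms_nonempty := hS.terms_nonempty.image π
      symm := fun x y => by
        simp only [RootedNetwork.map]
        rw [Finset.sum_comm]
        simp only [hS.symm]
      mult_nonneg := fun x y => Finset.sum_nonneg fun u _ => Finset.sum_nonneg fun v _ =>
        hS.mult_nonneg u v
      inn_nonneg := fun x => Finset.sum_nonneg fun u _ => hS.inn_nonneg u
      out_nonneg := fun x => Finset.sum_nonneg fun u _ => hS.out_nonneg u
      parity := fun x _ => by
        rw [cut_map]
        simp only [Finset.mem_singleton]
        exact two_dvd_cut_sub hS.symm hS.parity (Finset.filter_subset _ _)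
      bal_sum := by
        have := hS.bal_sum
        simp only [RootedNetwork.map, Finset.sum_sub_distrib, hall] at this ⊢
        exact this
      bal_off := fun x _ hx => Finset.dvd_sum fun u hu => by
        rw [Finset.mem_filter] at hu
        exact hS.bal_off u hu.1 fun h => hx (hu.2 ▸ Finset.mem_image_of_mem π h)
      root := by
        rw [cut_map]
        change S.cut {u ∈ S.verts | π u ∈ S.verts.image π} ≤ 2 * k - 2 +
          circNorm k (∑ x ∈ S.verts.image π, ∑ u ∈ S.verts with π u = x, S.bal u)
        rw [himg, hall]
        exact hS.root
      le_cut := fun B hB hB' => by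
        rw [cut_map]
        simp only [RootedNetwork.map, Finset.sum_fiberwise_eq_sum_filter]
        refine hS.le_cut _ ?_ ?_
        · obtain ⟨x, hx, hxB⟩ := Finset.exists_of_ssubset hB
          obtain ⟨u, hu, rfl⟩ := Finset.mem_image.1 hx
          exact Finset.filter_ssubset.2 ⟨u, hu, hxB⟩
        · obtain ⟨x, hx⟩ := hB'
          rw [Finset.mem_inter] at hx
          obtain ⟨u, hu, rfl⟩ := Finset.mem_image.1 hx.2
          exact ⟨u, Finset.mem_inter.2 ⟨Finset.mem_filter.2 ⟨hS.terms_subset hu, hx.1⟩, hu⟩⟩ }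

/-- The network on `A` where the remaining vertices are identified with the root, `g u v` of the
edges between `u ∉ A` and `v ∈ A` being directed towards `v`. -/
def restrict (S : RootedNetwork V) (A : Finset V) (g : V → V → ℤ) : RootedNetwork V where
  verts := A
  terms := S.terms ∩ A
  mult := S.mult
  inn v := S.inn v + ∑ u ∈ S.verts \ A, g u v
  out v := S.out v + ∑ u ∈ S.verts \ A, (S.mult u v - g u v)
  bal := S.bal

theorem cut_restrict {S : RootedNetwork V} (hs : ∀ u v, S.mult u v = S.mult v u) {A B : Finset V}
    (hA : A ⊆ S.verts) (hB : B ⊆ A) (g : V → V → ℤ) : (S.restrict A g).cut B = S.cut B := by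
  have h1 : S.verts \ B = A \ B ∪ S.verts \ A := by
    ext x
    have : x ∈ B → x ∈ A := fun h => hB h
    have : x ∈ A → x ∈ S.verts := fun h => hA h
    simp only [Finset.mem_sdiff, Finset.mem_union]
    tauto
  have h2 : Disjoint (A \ B) (S.verts \ A) :=
    Finset.disjoint_of_subset_left Finset.sdiff_subset Finset.disjoint_sdiff
  simp only [cut, restrict, h1, Finset.sum_union h2, Finset.sum_add_distrib,
    Finset.sum_sub_distrib, fun u v => hs v u]
  ring

theorem exists_sum_eq {m : V → ℤ} (hm : ∀ v, 0 ≤ m v) (A : Finset V) :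
    ∀ t : ℤ, 0 ≤ t → t ≤ ∑ v ∈ A, m v →
      ∃ g : V → ℤ, (∀ v, 0 ≤ g v ∧ g v ≤ m v) ∧ ∑ v ∈ A, g v = t := by
  induction A using Finset.induction_on with
  | empty =>
    intro t h1 h2
    exact ⟨fun _ => 0, fun v => ⟨le_rfl, hm v⟩, by simpa using le_antisymm h1 h2⟩
  | insert a A ha ih =>
    intro t h1 h2
    rw [Finset.sum_insert ha] at h2
    obtain ⟨g, hg, hg'⟩ := ih (min t (∑ v ∈ A, m v))
      (le_min h1 (Finset.sum_nonneg fun v _ => hm v)) (min_le_right _ _)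
    refine ⟨Function.update g a (t - min t (∑ v ∈ A, m v)), fun v => ?_, ?_⟩
    · by_cases h : v = a
      · subst h
        have := hm v
        rw [Function.update_self]
        omega
      · rw [Function.update_of_ne h]
        exact hg v
    · rw [Finset.sum_insert ha, Function.update_self,
        Finset.sum_congr rfl fun v hv => Function.update_of_ne (ne_of_mem_of_not_mem hv ha) _ g, hg']
      ring

theorem solvable_of_cut_eq_of_ssubset {S : RootedNetwork V} (hS : S.Good k)
    (ih : ∀ S' : RootedNetwork V, S'.Good k → S'.Smaller S → S'.Solvable k) {A : Finset V}
    (hA : A ⊂ S.verts) (hc : 1 < A.card) (hA' : (A ∩ S.terms).Nonempty)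
    (hcut : S.cut A ≤ 2 * k - 2 + circNorm k (∑ v ∈ A, S.bal v)) : S.Solvable k := by
  obtain ⟨a, ha⟩ : A.Nonempty := Finset.card_pos.1 (by omega)
  set π : V → V := fun v => if v ∈ A then a else v
  have hπA : ∀ v ∈ A, π v = a := fun v hv => if_pos hv
  have hπA' : ∀ v, v ∉ A → π v = v := fun v hv => if_neg hv
  have hfa : {u ∈ S.verts | π u = a} = A := by
    ext u
    rw [Finset.mem_filter]
    by_cases hu : u ∈ A
    · simp [hu, hA.1 hu, hπA]
    · simp only [hu, hπA' u hu, iff_false, not_and]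
      exact fun _ h => hu (h ▸ ha)
  have hfv : ∀ v ∈ S.verts, v ∉ A → {u ∈ S.verts | π u = v} = {v} := by
    intro v hv hvA
    ext u
    rw [Finset.mem_filter, Finset.mem_singleton]
    by_cases hu : u ∈ A
    · rw [hπA u hu]
      exact ⟨fun h => absurd (h.2 ▸ ha) hvA, fun h => absurd (h ▸ hu) hvA⟩
    · rw [hπA' u hu]
      exact ⟨fun h => h.2, fun h => ⟨h ▸ hv, h⟩⟩
  have hverts : (S.map π).verts = insert a (S.verts \ A) := by
    ext x
    simp only [map, Finset.mem_image, Finset.mem_insert, Finset.mem_sdiff]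
    constructor
    · rintro ⟨u, hu, rfl⟩
      by_cases huA : u ∈ A
      · exact Or.inl (hπA u huA)
      · rw [hπA' u huA]
        exact Or.inr ⟨hu, huA⟩
    · rintro (rfl | ⟨hx, hxA⟩)
      · exact ⟨x, hA.1 ha, hπA x ha⟩
      · exact ⟨x, hx, hπA' x hxA⟩
  have haW : a ∉ S.verts \ A := fun h => (Finset.mem_sdiff.1 h).2 ha
  obtain ⟨f, f1, f2, f3, f4⟩ := ih _ (hS.map π) (Or.inl (by
    rw [hverts, Finset.card_insert_of_notMem haW, Finset.card_sdiff_of_subset hA.1]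
    have := Finset.card_le_card hA.1
    omega))
  rw [hverts] at f2 f4
  have hma : ∀ u ∈ S.verts \ A, f u a + f a u = ∑ v ∈ A, S.mult u v := by
    intro u hu
    rw [f2 u (Finset.mem_insert_of_mem hu) a (Finset.mem_insert_self _ _)
      (ne_of_mem_of_not_mem hu haW)]
    rw [Finset.mem_sdiff] at hu
    simp only [map, hfa, hfv u hu.1 hu.2, Finset.sum_singleton]
  have hsplit : ∀ u, ∃ g : V → ℤ, (∀ v, 0 ≤ g v ∧ g v ≤ S.mult u v) ∧
      (u ∈ S.verts \ A → ∑ v ∈ A, g v = f u a) := by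
    intro u
    by_cases hu : u ∈ S.verts \ A
    · obtain ⟨g, h1, h2⟩ := exists_sum_eq (hS.mult_nonneg u) A (f u a) (f1 u a) (by
        have := hma u hu
        have := f1 a u
        omega)
      exact ⟨g, h1, fun _ => h2⟩
    · exact ⟨fun _ => 0, fun v => ⟨le_rfl, hS.mult_nonneg u v⟩, fun h => absurd h hu⟩
  choose g g1 g2 using hsplit
  have g3 : ∀ u ∈ S.verts \ A, ∑ v ∈ A, (S.mult u v - g u v) = f a u := by
    intro u hu
    rw [Finset.sum_sub_distrib, ← hma u hu, g2 u hu]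
    ring
  have hgood : (S.restrict A g).Good k :=
    { terms_subset := Finset.inter_subset_right
      terms_nonempty := by rwa [Finset.inter_comm] at hA'
      symm := hS.symm
      mult_nonneg := hS.mult_nonneg
      inn_nonneg := fun v => add_nonneg (hS.inn_nonneg v) (Finset.sum_nonneg fun u _ => (g1 u v).1)
      out_nonneg := fun v => add_nonneg (hS.out_nonneg v)
        (Finset.sum_nonneg fun u _ => sub_nonneg.2 (g1 u v).2)
      parity := fun v hv => by
        rw [cut_restrict hS.symm hA.1 (Finset.singleton_subset_iff.2 hv)]
        exact hS.parity v (hA.1 hv)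
      bal_sum := by
        obtain ⟨t, ht⟩ := hA'
        rw [Finset.mem_inter] at ht
        have := Int.dvd_neg.2 (f3 a (Finset.mem_image.2 ⟨t, ht.2, hπA t ht.1⟩))
        rw [neg_sub] at this
        convert this using 2
        · simp only [map, hfa]
          rfl
        · rw [net, hverts, Finset.sum_insert haW, sub_self, zero_add]
          simp only [map, hfa, restrict, Finset.sum_sub_distrib, Finset.sum_add_distrib]
          rw [← Finset.sum_congr rfl g3, ← Finset.sum_congr rfl g2]
          simp only [Finset.sum_sub_distrib]
          rw [Finset.sum_comm (s := A), Finset.sum_comm (s := A)]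
          ring
      bal_off := fun v hv hv' => hS.bal_off v (hA.1 hv) fun h => hv' (Finset.mem_inter.2 ⟨h, hv⟩)
      root := (cut_restrict hS.symm hA.1 (Finset.Subset.refl A) g).trans_le hcut
      le_cut := fun B hB hB' => by
        rw [cut_restrict hS.symm hA.1 hB.1]
        exact hS.le_cut B (hB.trans hA)
          (hB'.mono (Finset.inter_subset_inter_left Finset.inter_subset_left)) }
  obtain ⟨h, h1, h2, h3, h4⟩ := ih _ hgood (Or.inl (Finset.card_lt_card hA))
  have hnetA : ∀ v ∈ A, S.net (fun x y => if x ∈ A then if y ∈ A then h x y else S.mult y x - g y x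
      else if y ∈ A then g x y else f x y) v = (S.restrict A g).net h v := by
    intro v hv
    simp only [net, hv, if_true]
    rw [← Finset.sum_sdiff hA.1]
    rw [Finset.sum_congr (s₁ := A) rfl (g := fun u => h v u - h u v) fun u hu => by simp [hu],
      Finset.sum_congr (s₁ := S.verts \ A) rfl (g := fun u => S.mult u v - g u v - g u v)
        fun u hu => by simp [(Finset.mem_sdiff.1 hu).2]]
    simp only [restrict, Finset.sum_sub_distrib]
    ring
  have hnetA' : ∀ v ∈ S.verts \ A,
      S.net (fun x y => if x ∈ A then if y ∈ A then h x y else S.mult y x - g y x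
        else if y ∈ A then g x y else f x y) v = (S.map π).net f v := by
    intro v hv
    have hv' := Finset.mem_sdiff.1 hv
    simp only [net, hv'.2, if_false]
    rw [hverts, Finset.sum_insert haW, ← Finset.sum_sdiff hA.1]
    rw [Finset.sum_congr (s₁ := A) rfl (g := fun u => g v u - (S.mult v u - g v u))
        fun u hu => by simp [hu],
      Finset.sum_congr (s₁ := S.verts \ A) rfl (g := fun u => f v u - f u v)
        fun u hu => by simp [(Finset.mem_sdiff.1 hu).2],
      Finset.sum_sub_distrib (s := A), g2 v hv, g3 v hv]
    simp only [map, hfv v hv'.1 hv'.2, Finset.sum_singleton]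
    ring
  refine ⟨fun x y => if x ∈ A then if y ∈ A then h x y else S.mult y x - g y x
    else if y ∈ A then g x y else f x y, fun x y => ?_, fun x hx y hy hxy => ?_, fun v hv => ?_,
    fun v hv hvT => ?_⟩
  · dsimp only
    split_ifs
    · exact h1 x y
    · exact sub_nonneg.2 (g1 y x).2
    · exact (g1 x y).1
    · exact f1 x y
  · by_cases hxA : x ∈ A <;> by_cases hyA : y ∈ A <;> simp only [hxA, hyA, if_true, if_false]
    · exact h2 x hxA y hyA hxy
    · rw [hS.symm]
      ring
    · ring
    · rw [f2 x (Finset.mem_insert_of_mem (Finset.mem_sdiff.2 ⟨hx, hxA⟩)) y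
        (Finset.mem_insert_of_mem (Finset.mem_sdiff.2 ⟨hy, hyA⟩)) hxy]
      simp only [map, hfv x hx hxA, hfv y hy hyA, Finset.sum_singleton]
  · by_cases hvA : v ∈ A
    · rw [hnetA v hvA]
      exact h3 v (Finset.mem_inter.2 ⟨hv, hvA⟩)
    · have hvW := hS.terms_subset hv
      rw [hnetA' v (Finset.mem_sdiff.2 ⟨hvW, hvA⟩)]
      have := f3 v (Finset.mem_image.2 ⟨v, hv, hπA' v hvA⟩)
      simpa only [map, hfv v hvW hvA, Finset.sum_singleton] using this
  · by_cases hvA : v ∈ A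
    · rw [hnetA v hvA]
      exact h4 v hvA fun h => hvT (Finset.mem_inter.1 h).1
    · have hv' := Finset.mem_sdiff.2 ⟨hv, hvA⟩
      rw [hnetA' v hv']
      refine f4 v (Finset.mem_insert_of_mem hv') fun hm => ?_
      obtain ⟨t, ht, htv⟩ := Finset.mem_image.1 hm
      by_cases htA : t ∈ A
      · rw [hπA t htA] at htv
        exact hvA (htv ▸ ha)
      · rw [hπA' t htA] at htv
        exact hvT (htv ▸ ht)

theorem Good.solvable_of_forall_smaller {S : RootedNetwork V} (hk : 1 < k) (hS : S.Good k)
    (ih : ∀ S' : RootedNetwork V, S'.Good k → S'.Smaller S → S'.Solvable k) : S.Solvable k := by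
  by_cases htight : ∃ A, A ⊂ S.verts ∧ 1 < A.card ∧ (A ∩ S.terms).Nonempty ∧
      S.cut A ≤ 2 * k - 2 + circNorm k (∑ v ∈ A, S.bal v)
  · obtain ⟨A, hA, hc, hA', hcut⟩ := htight
    exact solvable_of_cut_eq_of_ssubset hS ih hA hc hA' hcut
  push Not at htight
  have hslack : S.Slack k := fun A hA hc hA' =>
    hS.le_cut_add_two (by omega) hA.1 (htight A hA hc hA')
  by_cases hT : S.terms = S.verts
  · rcases Nat.lt_or_ge 1 S.verts.card with hc | hc
    · exact solvable_of_terms_eq_verts hk hS ih hslack hT hc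
    · obtain ⟨y, hy⟩ := Finset.card_eq_one.1 (le_antisymm hc
        (Finset.card_pos.2 (hT ▸ hS.terms_nonempty)))
      have hb := hS.bal_sum
      simp only [hy, Finset.sum_singleton] at hb
      refine ⟨fun _ _ => 0, fun _ _ => le_rfl, fun u hu v hv huv => ?_, fun v hv => ?_,
        fun v hv hv' => absurd (hT ▸ hv) hv'⟩
      · rw [hy, Finset.mem_singleton] at hu hv
        exact absurd (hu.trans hv.symm) huv
      · rw [hT, hy, Finset.mem_singleton] at hv
        subst hv
        rw [← Int.dvd_neg]
        simpa [net] using hb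
  · obtain ⟨v, hv, hvT⟩ := Finset.exists_of_ssubset (hS.terms_subset.ssubset_of_ne hT)
    exact solvable_of_mem_of_notMem_terms (by omega) hS ih hslack hv hvT

theorem Good.cut_nonneg {S : RootedNetwork V} (hS : S.Good k) (A : Finset V) : 0 ≤ S.cut A :=
  add_nonneg (Finset.sum_nonneg fun u _ => Finset.sum_nonneg fun v _ => hS.mult_nonneg u v)
    (Finset.sum_nonneg fun u _ => add_nonneg (hS.inn_nonneg u) (hS.out_nonneg u))

theorem Good.solvable (hk : 1 < k) {S : RootedNetwork V} (hS : S.Good k) : S.Solvable k := by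
  let μ : RootedNetwork V → ℕ ×ₗ ℕ ×ₗ ℕ := fun S => toLex (S.verts.card,
    toLex ((∑ u ∈ S.verts, ∑ v ∈ S.verts, S.mult u v).toNat,
      (S.cut S.verts + S.terms.card).toNat))
  induction h : μ S using WellFoundedLT.induction generalizing S with
  | ind x ih =>
    subst h
    refine hS.solvable_of_forall_smaller hk fun S' hS' hlt => ih (μ S') ?_ hS' rfl
    have hm : 0 ≤ ∑ u ∈ S.verts, ∑ v ∈ S.verts, S.mult u v :=
      Finset.sum_nonneg fun u _ => Finset.sum_nonneg fun v _ => hS.mult_nonneg u v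
    have hm' : 0 ≤ ∑ u ∈ S'.verts, ∑ v ∈ S'.verts, S'.mult u v :=
      Finset.sum_nonneg fun u _ => Finset.sum_nonneg fun v _ => hS'.mult_nonneg u v
    have hc := hS.cut_nonneg S.verts
    have hc' := hS'.cut_nonneg S'.verts
    rcases hlt with hlt | ⟨hv, hlt | ⟨he, hlt⟩⟩
    · exact Prod.Lex.toLex_lt_toLex.2 (Or.inl hlt)
    · refine Prod.Lex.toLex_lt_toLex.2 (Or.inr ⟨by rw [hv], ?_⟩)
      refine Prod.Lex.toLex_lt_toLex.2 (Or.inl ?_)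
      dsimp only
      omega
    · refine Prod.Lex.toLex_lt_toLex.2 (Or.inr ⟨by rw [hv], ?_⟩)
      refine Prod.Lex.toLex_lt_toLex.2 (Or.inr ⟨?_, ?_⟩)
      · dsimp only
        rw [he]
      · dsimp only
        omega

end RootedNetwork

namespace Multigraph

variable {V E : Type} {G : Multigraph V E}

theorem IsBipartition.existsUnique_left {A B : Finset V} (hbip : G.IsBipartition ↑A ↑B) (e : E) :
    ∃! v, v ∈ A ∧ v ∈ G.ends e := by
  obtain ⟨a, ha, b, hb, hab⟩ := hbip.2.2 e
  refine ⟨a, ⟨ha, hab ▸ Sym2.mem_mk_left a b⟩, fun x ⟨hx, hxe⟩ => ?_⟩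
  rw [hab, Sym2.mem_iff] at hxe
  rcases hxe with rfl | rfl
  · rfl
  · exact absurd hb (Set.disjoint_left.1 hbip.1 hx)

theorem IsBipartition.symm {A B : Finset V} (hbip : G.IsBipartition ↑A ↑B) :
    G.IsBipartition ↑B ↑A := by
  refine ⟨hbip.1.symm, by rw [Set.union_comm]; exact hbip.2.1, fun e => ?_⟩
  obtain ⟨a, ha, b, hb, hab⟩ := hbip.2.2 e
  exact ⟨b, hb, a, ha, hab.trans Sym2.eq_swap⟩

theorem IsBipartition.exists_eq {A B : Finset V} (hbip : G.IsBipartition ↑A ↑B) {v : V}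
    (hv : v ∈ A) (e : E) (he : v ∈ G.ends e) : ∃ u ∈ B, G.ends e = s(v, u) := by
  obtain ⟨a, ha, b, hb, hab⟩ := hbip.2.2 e
  obtain rfl := (hbip.existsUnique_left e).unique ⟨hv, he⟩ ⟨ha, hab ▸ Sym2.mem_mk_left a b⟩
  exact ⟨b, hb, hab⟩

variable [Fintype E] [DecidableEq V]

open Classical in
/-- The number of edges joining `u` and `v`. -/
noncomputable def edgeCount (G : Multigraph V E) (u v : V) : ℕ :=
  Finset.card {e | G.ends e = s(u, v)}

theorem edgeCount_comm (u v : V) : G.edgeCount u v = G.edgeCount v u := by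
  rw [edgeCount, edgeCount, Sym2.eq_swap]

open Classical in
theorem degOn_eq_sum (H : Set E) {v : V} {X : Finset V}
    (hX : ∀ e, v ∈ G.ends e → ∃ u ∈ X, G.ends e = s(v, u)) :
    G.degOn H v = ∑ u ∈ X, Finset.card {e | e ∈ H ∧ G.ends e = s(v, u)} := by
  rw [degOn, Nat.card_eq_fintype_card, Fintype.card_subtype, ← Finset.card_biUnion]
  · congr 1
    ext e
    simp only [Finset.mem_filter, Finset.mem_univ, true_and, Finset.mem_biUnion]
    constructor
    · rintro ⟨he, hv⟩
      obtain ⟨u, hu, h⟩ := hX e hv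
      exact ⟨u, hu, he, h⟩
    · rintro ⟨u, -, he, h⟩
      exact ⟨he, h ▸ Sym2.mem_mk_left v u⟩
  · intro u _ w _ huw
    refine Finset.disjoint_left.2 fun e hu hw => huw ?_
    simp only [Finset.mem_filter, Finset.mem_univ, true_and] at hu hw
    exact Sym2.congr_right.1 (hu.2.symm.trans hw.2)

theorem deg_eq_sum {v : V} {X : Finset V}
    (hX : ∀ e, v ∈ G.ends e → ∃ u ∈ X, G.ends e = s(v, u)) :
    G.deg v = ∑ u ∈ X, G.edgeCount v u := by
  simpa [degOn, deg, edgeCount] using degOn_eq_sum Set.univ hX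

theorem deg_eq_sum_erase [Fintype V] (G : Multigraph V E) (v : V) :
    G.deg v = ∑ u ∈ Finset.univ \ {v}, G.edgeCount v u := by
  refine deg_eq_sum fun e he => ?_
  obtain ⟨u, hu⟩ := Sym2.mem_iff_exists.1 he
  refine ⟨u, ?_, hu⟩
  simp only [Finset.mem_sdiff, Finset.mem_univ, Finset.mem_singleton, true_and]
  rintro rfl
  exact G.loopless e (by rw [hu]; rfl)

theorem sum_deg_eq_card {X : Finset V} (hX : ∀ e, ∃! v, v ∈ X ∧ v ∈ G.ends e) :
    ∑ v ∈ X, G.deg v = Nat.card E := by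
  classical
  simp only [deg, Nat.card_eq_fintype_card, Fintype.card_subtype]
  rw [← Finset.card_biUnion, ← Finset.card_univ]
  · congr 1
    ext e
    obtain ⟨v, hv, -⟩ := hX e
    simpa using ⟨v, hv⟩
  · intro v hv w hw hvw
    refine Finset.disjoint_left.2 fun e he he' => hvw ?_
    exact (hX e).unique ⟨hv, (Finset.mem_filter.1 he).2⟩ ⟨hw, (Finset.mem_filter.1 he').2⟩

theorem EdgeConnected.le_sum [Fintype V] {n : ℕ} (hG : G.EdgeConnected n) {X : Finset V}
    (hX : X ⊂ Finset.univ) (hX' : X.Nonempty) :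
    n ≤ ∑ u ∈ X, ∑ v ∈ Finset.univ \ X, G.edgeCount u v := by
  classical
  let F : Finset E := X.biUnion fun u => (Finset.univ \ X).biUnion fun v => {e | G.ends e = s(u, v)}
  have hF : F.card ≤ ∑ u ∈ X, ∑ v ∈ Finset.univ \ X, G.edgeCount u v :=
    Finset.card_biUnion_le.trans (Finset.sum_le_sum fun u _ => Finset.card_biUnion_le)
  by_contra hlt
  obtain ⟨x, hx⟩ := hX'
  obtain ⟨y, -, hy⟩ := Finset.exists_of_ssubset hX
  refine hy ?_
  clear hy
  have h := hG F (by omega) x y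
  induction h with
  | refl => exact hx
  | @tail b c _ hbc ih =>
    by_contra hc
    obtain ⟨e, he, hbc⟩ := hbc
    refine he ?_
    simp only [F, Finset.mem_biUnion, Finset.mem_sdiff, Finset.mem_univ, true_and,
      Finset.mem_filter]
    exact ⟨b, ih, c, hc, hbc⟩

/-- The network of `G` with terminals `B` whose solutions have out-degree congruent to `p v` at
`v ∈ B`. -/
noncomputable def toRootedNetwork [Fintype V] (G : Multigraph V E) (B : Finset V) (p : V → ℕ) :
    RootedNetwork V where
  verts := Finset.univ
  terms := B
  mult u v := G.edgeCount u v
  inn _ := 0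
  out _ := 0
  bal v := if v ∈ B then 2 * p v - G.deg v else 0

theorem good_toRootedNetwork [Fintype V] {B : Finset V} {p : V → ℕ} {k : ℕ} (hk : 0 < k) (hB : B.Nonempty)
    (hG : G.EdgeConnected (3 * k - 2)) (heven : ∀ v ∉ B, 2 ∣ G.deg v)
    (hsum : (2 * k : ℤ) ∣ ∑ v ∈ B, (2 * p v - G.deg v : ℤ)) :
    (G.toRootedNetwork B p).Good k where
  terms_subset := Finset.subset_univ _
  terms_nonempty := hB
  symm u v := congrArg Nat.cast (edgeCount_comm u v)
  mult_nonneg _ _ := Nat.cast_nonneg _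
  inn_nonneg _ := le_rfl
  out_nonneg _ := le_rfl
  parity v _ := by
    have hd : (G.toRootedNetwork B p).cut {v} = G.deg v := by
      rw [RootedNetwork.cut_singleton, deg_eq_sum_erase]
      simp [toRootedNetwork]
    rw [hd]
    simp only [toRootedNetwork]
    split_ifs with h
    · omega
    · have := heven v h
      omega
  bal_sum := by simpa [toRootedNetwork] using hsum
  bal_off v _ hv := by
    rw [show (G.toRootedNetwork B p).bal v = 0 from if_neg hv]
    exact dvd_zero _
  root := by
    rw [RootedNetwork.cut_verts]
    simp only [toRootedNetwork, add_zero, Finset.sum_const_zero]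
    have := circNorm_nonneg (k := k) (∑ v, if v ∈ B then 2 * (p v : ℤ) - G.deg v else 0)
    omega
  le_cut X hX hX' := by
    have h1 := hG.le_sum hX (hX'.mono Finset.inter_subset_left)
    have h2 := circNorm_le hk (∑ v ∈ X, (G.toRootedNetwork B p).bal v)
    have h3 : (G.toRootedNetwork B p).cut X =
        (∑ u ∈ X, ∑ v ∈ Finset.univ \ X, G.edgeCount u v : ℕ) := by
      simp [RootedNetwork.cut, toRootedNetwork]
    omega

theorem exists_half_subgraph {A B : Finset V} (hbip : G.IsBipartition ↑A ↑B)
    (heven : ∀ v ∈ A, 2 ∣ G.deg v) : ∃ H : Set E, ∀ v ∈ A, 2 * G.degOn H v = G.deg v := by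
  classical
  have h : ∀ v, ∃ S : Finset E, S ⊆ ({e | v ∈ G.ends e} : Finset E) ∧ S.card = G.deg v / 2 := by
    intro v
    refine Finset.exists_subset_card_eq ?_
    rw [deg, Nat.card_eq_fintype_card, Fintype.card_subtype]
    exact Nat.div_le_self _ _
  choose S hS hS' using h
  refine ⟨{e | ∃ v ∈ A, e ∈ S v}, fun v hv => ?_⟩
  have hSv : ({e | e ∈ {e | ∃ v ∈ A, e ∈ S v} ∧ v ∈ G.ends e} : Finset E) = S v := by
    ext e
    simp only [Finset.mem_filter, Finset.mem_univ, true_and, Set.mem_ofPred_eq]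
    refine ⟨?_, fun he => ⟨⟨v, hv, he⟩, (Finset.mem_filter.1 (hS v he)).2⟩⟩
    rintro ⟨⟨w, hw, he⟩, hve⟩
    have hwe := (Finset.mem_filter.1 (hS w he)).2
    rwa [(hbip.existsUnique_left e).unique ⟨hv, hve⟩ ⟨hw, hwe⟩]
  rw [degOn, Nat.card_eq_fintype_card, Fintype.card_subtype, hSv, hS']
  have := heven v hv
  omega

theorem IsBipartition.edgeCount_eq_zero {A B : Finset V} (hbip : G.IsBipartition ↑A ↑B) {u v : V}
    (hu : u ∈ A) (hv : v ∈ A) : G.edgeCount u v = 0 := by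
  refine Finset.card_eq_zero.2 (Finset.filter_eq_empty_iff.2 fun e _ he => G.loopless e ?_)
  obtain rfl := (hbip.existsUnique_left e).unique ⟨hu, he ▸ Sym2.mem_mk_left u v⟩
    ⟨hv, he ▸ Sym2.mem_mk_right u v⟩
  rw [he]
  rfl

/-- The edge set obtained from an orientation by taking the edges directed from `B` to `A`. -/
theorem IsBipartition.exists_degOn_eq_sum {A B : Finset V} (hbip : G.IsBipartition ↑A ↑B)
    {f : V → V → ℕ} (hf : ∀ b ∈ B, ∀ a ∈ A, f b a ≤ G.edgeCount b a) :
    ∃ H : Set E, (∀ a ∈ A, G.degOn H a = ∑ b ∈ B, f b a) ∧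
      ∀ b ∈ B, G.degOn H b = ∑ a ∈ A, f b a := by
  classical
  have h : ∀ b a, ∃ T : Finset E, b ∈ B → a ∈ A →
      T ⊆ ({e | G.ends e = s(b, a)} : Finset E) ∧ T.card = f b a := by
    intro b a
    by_cases hba : b ∈ B ∧ a ∈ A
    · obtain ⟨T, hT⟩ := Finset.exists_subset_card_eq (hf b hba.1 a hba.2)
      refine ⟨T, fun _ _ => ⟨hT.1.trans_eq ?_, hT.2⟩⟩
      congr
    · exact ⟨∅, fun hb ha => absurd ⟨hb, ha⟩ hba⟩
  choose T hT using h
  have hH : ∀ b ∈ B, ∀ a ∈ A,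
      ({e | e ∈ {e | ∃ b ∈ B, ∃ a ∈ A, e ∈ T b a} ∧ G.ends e = s(b, a)} : Finset E).card =
        f b a := by
    intro b hb a ha
    rw [← (hT b a hb ha).2]
    congr 1
    ext e
    simp only [Finset.mem_filter, Finset.mem_univ, true_and, Set.mem_ofPred_eq]
    refine ⟨?_, fun he => ⟨⟨b, hb, a, ha, he⟩, (Finset.mem_filter.1 ((hT b a hb ha).1 he)).2⟩⟩
    rintro ⟨⟨b', hb', a', ha', he⟩, hba⟩
    have hba' := (Finset.mem_filter.1 ((hT b' a' hb' ha').1 he)).2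
    obtain rfl := (hbip.existsUnique_left e).unique ⟨ha, hba ▸ Sym2.mem_mk_right b a⟩
      ⟨ha', hba' ▸ Sym2.mem_mk_right b' a'⟩
    obtain rfl := (hbip.symm.existsUnique_left e).unique ⟨hb, hba ▸ Sym2.mem_mk_left b a⟩
      ⟨hb', hba' ▸ Sym2.mem_mk_left b' a⟩
    exact he
  refine ⟨{e | ∃ b ∈ B, ∃ a ∈ A, e ∈ T b a}, fun a ha => ?_, fun b hb => ?_⟩
  · rw [degOn_eq_sum _ (hbip.exists_eq ha)]
    refine Finset.sum_congr rfl fun b hb => ?_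
    rw [← hH b hb a ha]
    simp only [@Sym2.eq_swap _ a b]
  · rw [degOn_eq_sum _ (hbip.symm.exists_eq hb)]
    refine Finset.sum_congr rfl fun a ha => ?_
    rw [← hH b hb a ha]
    congr

theorem net_toRootedNetwork [Fintype V] {B X Y : Finset V} {p : V → ℕ}
    (hbip : G.IsBipartition ↑X ↑Y) {f : V → V → ℤ} (hf : ∀ u v, 0 ≤ f u v)
    (hf' : ∀ u v, u ≠ v → f u v + f v u = G.edgeCount u v) {v : V} (hv : v ∈ X) :
    (G.toRootedNetwork B p).net f v = 2 * ∑ u ∈ Y, f v u - G.deg v := by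
  have hX : ∀ u ∉ Y, u ∈ X := fun u hu =>
    (hbip.2.1.ge (Set.mem_univ u)).resolve_right hu
  have hYv : ∀ u ∈ Y, v ≠ u := fun u hu h => Set.disjoint_left.1 hbip.1 hv (h ▸ hu)
  rw [deg_eq_sum (hbip.exists_eq hv), Nat.cast_sum, Finset.mul_sum, ← Finset.sum_sub_distrib]
  simp only [RootedNetwork.net, toRootedNetwork, add_zero, sub_zero]
  rw [← Finset.sum_subset (Finset.subset_univ Y)]
  · refine Finset.sum_congr rfl fun u hu => ?_
    rw [← hf' v u (hYv u hu)]
    ring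
  · intro u _ hu
    by_cases huv : v = u
    · rw [huv, sub_self]
    · have h1 := hf' v u huv
      rw [hbip.edgeCount_eq_zero hv (hX u hu)] at h1
      have := hf v u
      have := hf u v
      omega

theorem exists_half_subgraph_of_one_lt [Fintype V] {A B : Finset V} {k : ℕ} (hk : 1 < k)
    (hbip : G.IsBipartition ↑A ↑B) (hB : B.Nonempty) (hcon : G.EdgeConnected (3 * k - 2))
    (heven : ∀ v ∈ A, 2 ∣ G.deg v) (p : V → ZMod k)
    (hsum : ∑ v ∈ B, p v = ((Nat.card E / 2 : ℕ) : ZMod k)) :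
    ∃ H : Set E, (∀ v ∈ A, 2 * G.degOn H v = G.deg v) ∧
      ∀ v ∈ B, (G.degOn H v : ZMod k) = p v := by
  have : NeZero k := ⟨by omega⟩
  have hA : ∀ v ∉ B, v ∈ A := fun v hv => (hbip.2.1.ge (Set.mem_univ v)).resolve_right hv
  have hdvd : (2 * k : ℤ) ∣ ∑ v ∈ B, (2 * ((p v).val : ℕ) - G.deg v : ℤ) := by
    have hE : 2 ∣ Nat.card E :=
      sum_deg_eq_card hbip.existsUnique_left ▸ Finset.dvd_sum heven
    obtain ⟨m, hm⟩ := hE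
    rw [Finset.sum_sub_distrib, ← Finset.mul_sum, ← Nat.cast_sum, ← Nat.cast_sum,
      sum_deg_eq_card hbip.symm.existsUnique_left, hm]
    have h1 : ((∑ v ∈ B, (p v).val : ℕ) : ZMod k) = (m : ℕ) := by
      rw [hm, Nat.mul_div_cancel_left m two_pos] at hsum
      simpa using hsum
    have h2 : (k : ℤ) ∣ (∑ v ∈ B, (p v).val : ℕ) - (m : ℕ) := by
      rw [← ZMod.intCast_zmod_eq_zero_iff_dvd]
      push_cast at h1 ⊢
      exact sub_eq_zero.2 h1
    obtain ⟨c, hc⟩ := h2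
    exact ⟨c, by push_cast at hc ⊢; linear_combination 2 * hc⟩
  obtain ⟨f, f1, f2, f3, f4⟩ := (good_toRootedNetwork (by omega) hB hcon
    (fun v hv => heven v (hA v hv)) hdvd).solvable hk
  have hf' : ∀ u v, u ≠ v → f u v + f v u = G.edgeCount u v := fun u v =>
    f2 u (Finset.mem_univ u) v (Finset.mem_univ v)
  have hAB : ∀ b ∈ B, ∀ a ∈ A, b ≠ a := fun b hb a ha h =>
    Set.disjoint_left.1 hbip.1 ha (h ▸ hb)
  obtain ⟨H, hHA, hHB⟩ := hbip.exists_degOn_eq_sum (f := fun u v => (f u v).toNat)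
    fun b hb a ha => by
      have := hf' b a (hAB b hb a ha)
      have := f1 a b
      omega
  have hcast : ∀ u v, ((f u v).toNat : ℤ) = f u v := fun u v => Int.toNat_of_nonneg (f1 u v)
  refine ⟨H, fun a ha => ?_, fun b hb => ?_⟩
  · have hnet := f4 a (Finset.mem_univ a) fun hb => hAB a hb a ha rfl
    rw [net_toRootedNetwork hbip f1 hf' ha] at hnet
    have hdeg : (G.degOn H a : ℤ) = ∑ b ∈ B, (G.edgeCount a b - f a b) := by
      rw [hHA a ha]
      push_cast
      refine Finset.sum_congr rfl fun b hb => ?_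
      rw [hcast, ← hf' a b (hAB b hb a ha).symm]
      ring
    rw [Finset.sum_sub_distrib, ← Nat.cast_sum, ← deg_eq_sum (hbip.exists_eq ha)] at hdeg
    omega
  · have hnet := f3 b hb
    rw [net_toRootedNetwork hbip.symm f1 hf' hb,
      show (G.toRootedNetwork B fun v => (p v).val).bal b = 2 * (p b).val - G.deg b from
        if_pos hb] at hnet
    have hdeg : (G.degOn H b : ℤ) = ∑ a ∈ A, f b a := by
      rw [hHB b hb]
      push_cast
      exact Finset.sum_congr rfl fun a _ => hcast b a
    rw [← hdeg] at hnet
    obtain ⟨c, hc⟩ := hnet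
    have hdvd : (k : ℤ) ∣ G.degOn H b - (p b).val := ⟨c,
      mul_left_cancel₀ (two_ne_zero (α := ℤ)) (by linear_combination hc)⟩
    rw [← ZMod.intCast_zmod_eq_zero_iff_dvd] at hdvd
    push_cast at hdvd
    rw [ZMod.natCast_val, ZMod.cast_id] at hdvd
    exact sub_eq_zero.1 hdvd

end Multigraph

open Multigraph in
/-- in a `(3k-2)`-edge-connected bipartite graph with even degrees on `A`,
for any prescription `p` on `B` summing to `e(G)/2 (mod k)` there is a subgraph taking
exactly half the degree at each vertex of `A` and degree `≡ p(v) (mod k)` at each `v ∈ B`. -/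
theorem half_degree_subgraph_with_prescription {V E : Type} [Fintype V] [Fintype E]
    (G : Multigraph V E) (A B : Finset V) (k : ℕ) (hk : 0 < k)
    (hbip : G.IsBipartition ↑A ↑B)
    (hcon : G.EdgeConnected (3 * k - 2))
    (heven : ∀ v ∈ A, 2 ∣ G.deg v)
    (p : V → ZMod k)
    (hsum : ∑ v ∈ B, p v = ((Nat.card E / 2 : ℕ) : ZMod k)) :
    ∃ H : Set E, (∀ v ∈ A, 2 * G.degOn H v = G.deg v) ∧
      ∀ v ∈ B, (G.degOn H v : ZMod k) = p v := by
  classical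
  rcases B.eq_empty_or_nonempty with rfl | hB
  · obtain ⟨H, hH⟩ := exists_half_subgraph hbip heven
    exact ⟨H, hH, fun v hv => absurd hv (Finset.notMem_empty v)⟩
  rcases Nat.lt_or_ge 1 k with h1 | h1
  · exact exists_half_subgraph_of_one_lt h1 hbip hB hcon heven p hsum
  · obtain rfl : k = 1 := by omega
    obtain ⟨H, hH⟩ := exists_half_subgraph hbip heven
    exact ⟨H, hH, fun v _ => Subsingleton.elim _ _⟩
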